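/- arXiv:2209.04894 — 2 statements merged into one kernel-verified Lean document; each statement's English description precedes it below -/
import Mathlib

section
/- For every integer k ≥ 2 there exists a real θ > log₂ 3 such that for every ε > 0 there exists n₀ with the following property: every T_k-free partially directed k-graph H on n ≥ n₀ vertices satisfies e_u(H) + θ·e_d(H) ≤ (1+ε)·C(n,k), where C(n,k) is the binomial coefficient 'n choose k'. -/
section Defs

variable {V W : Type*}

/-- A clause is a finite set of literals; a literal is a variable paired with a polarity
(`true` = positive, `false` = negative). -/
abbrev SatClause (V : Type*) := Finset (V × Bool)

/-- A formula is a finite set of clauses. -/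
abbrev SatFormula (V : Type*) := Finset (SatClause V)

/-- The set of variables used by a clause. -/
def clauseVars [DecidableEq V] (C : SatClause V) : Finset V := C.image Prod.fst

/-- A valid `k`-SAT clause: `k` literals on `k` distinct variables. -/
def IsKClause [DecidableEq V] (k : ℕ) (C : SatClause V) : Prop :=
  C.card = k ∧ (clauseVars C).card = k

/-- A valid `k`-SAT formula. -/
def IsKFormula [DecidableEq V] (k : ℕ) (G : SatFormula V) : Prop :=
  ∀ C ∈ G, IsKClause k C

/-- An assignment satisfies a clause if it makes all of its literals true. -/
def SatisfiesClause (a : V → Bool) (C : SatClause V) : Prop := ∀ l ∈ C, a l.1 = l.2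

/-- A formula is minimal if every clause has a witness assignment satisfying it and no other
clause. -/
def MinimalFormula (G : SatFormula V) : Prop :=
  ∀ C ∈ G, ∃ w : V → Bool, SatisfiesClause w C ∧ ∀ C' ∈ G, SatisfiesClause w C' → C' = C

/-- A formula is simple if no two distinct clauses use the same set of variables. -/
def SimpleFormula [DecidableEq V] (G : SatFormula V) : Prop :=
  ∀ C ∈ G, ∀ C' ∈ G, clauseVars C = clauseVars C' → C = C'

/-- A formula is unate if every variable occurs with only one polarity. -/
def UnateFormula (G : SatFormula V) : Prop :=
  ∀ x : V, ¬ ((∃ C ∈ G, (x, true) ∈ C) ∧ (∃ C ∈ G, (x, false) ∈ C))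

/-- The set of variables used by a formula. -/
def formulaVars [DecidableEq V] (G : SatFormula V) : Finset V := G.biUnion clauseVars

/-- `f` is a `k`-SAT function: it is computed by some `k`-SAT formula (value `1` iff some
clause has all its literals satisfied). -/
def IsKSatFunction (k n : ℕ) (f : (Fin n → Bool) → Bool) : Prop :=
  ∃ G : SatFormula (Fin n), IsKFormula k G ∧
    ∀ a : Fin n → Bool, f a = true ↔ ∃ C ∈ G, SatisfiesClause a C

/-- Relabel the variables of a formula along `φ`. -/
def mapFormula [DecidableEq V] [DecidableEq W] (φ : W → V) (F : SatFormula W) : SatFormula V :=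
  F.image (fun C => C.image (fun l => (φ l.1, l.2)))

/-- `G'` is a copy of `F`: it is obtained from `F` by an injective relabeling of variables. -/
def IsCopyOf [DecidableEq V] [DecidableEq W] (F : SatFormula W) (G' : SatFormula V) : Prop :=
  ∃ φ : W → V, Set.InjOn φ ↑(formulaVars F) ∧ G' = mapFormula φ F

/-- The number of copies of `F` in `G`, i.e. of subformulae of `G` isomorphic to `F`. -/
noncomputable def copyCount [DecidableEq V] [DecidableEq W] (F : SatFormula W)
    (G : SatFormula V) : ℕ :=
  Set.ncard {G' : SatFormula V | G' ⊆ G ∧ IsCopyOf F G'}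

/-- The `b`-blowup of a clause: replace each literal by the literal of the same polarity on
one of the `b` duplicates of its variable, in all possible ways. -/
def clauseBlowup [DecidableEq V] (b : ℕ) (C : SatClause V) :
    Finset (SatClause (V × Fin b)) :=
  (C.pi (fun _ => (Finset.univ : Finset (Fin b)))).image
    (fun g => C.attach.image (fun l => ((l.1.1, g l.1 l.2), l.1.2)))

/-- The `b`-blowup of a formula. -/
def formulaBlowup [DecidableEq V] (b : ℕ) (G : SatFormula V) : SatFormula (V × Fin b) :=
  G.biUnion (clauseBlowup b)

/-- The weight of a formula on `n` variables:
`wt(G) = Σ_i log₂(i+1)·α_i(G)` where `α_i(G)·C(n,k)` counts the `k`-sets of variables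
supporting exactly `i` clauses. -/
noncomputable def formulaWt (k n : ℕ) (G : SatFormula (Fin n)) : ℝ :=
  (∑ S ∈ (Finset.univ : Finset (Fin n)).powersetCard k,
    Real.logb 2 (((G.filter (fun C => clauseVars C = S)).card : ℝ) + 1)) / (n.choose k)

/-- A partially directed graph: a set of undirected edges together with a set of directed
(pointed) edges. -/
structure PDG (V : Type*) where
  undir : Finset (Finset V)
  dir : Finset (Finset V × V)

/-- `H` is a valid `k`-PDG: all edges have `k` vertices, each directed edge is pointed at one
of its vertices, and each `k`-set carries at most one edge (undirected or directed). -/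
def PDG.IsValid (k : ℕ) (H : PDG V) : Prop :=
  (∀ e ∈ H.undir, e.card = k) ∧
  (∀ p ∈ H.dir, p.1.card = k ∧ p.2 ∈ p.1) ∧
  (∀ p ∈ H.dir, p.1 ∉ H.undir) ∧
  (∀ p ∈ H.dir, ∀ q ∈ H.dir, p.1 = q.1 → p = q)

/-- `F` is a subgraph of `H`: a copy of `F` can be obtained from `H` by deleting vertices,
deleting edges, and/or forgetting directions of edges. -/
def PDG.IsSubgraph [DecidableEq V] (F : PDG W) (H : PDG V) : Prop :=
  ∃ φ : W → V, Function.Injective φ ∧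
    (∀ e ∈ F.undir, e.image φ ∈ H.undir ∨ ∃ v, (e.image φ, v) ∈ H.dir) ∧
    (∀ p ∈ F.dir, (p.1.image φ, φ p.2) ∈ H.dir)

/-- The image of a PDG under a relabeling of vertices. -/
def PDG.map [DecidableEq V] (φ : W → V) (F : PDG W) : PDG V :=
  ⟨F.undir.image (Finset.image φ), F.dir.image (fun p => (p.1.image φ, φ p.2))⟩

/-- The PDG `T_k` on vertex set `{0, …, k}` (0-indexed): undirected edges everything-but-`k`
and everything-but-`k-2`, and the edge everything-but-`k-1` directed toward `k`. -/
def TkPDG (k : ℕ) : PDG (Fin (k + 1)) where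
  undir := { Finset.univ.erase ⟨k, Nat.lt_succ_self k⟩,
             Finset.univ.erase ⟨k - 2, by omega⟩ }
  dir := { (Finset.univ.erase ⟨k - 1, by omega⟩, ⟨k, Nat.lt_succ_self k⟩) }

/-- A semisimple formula: every `k`-set of variables supports at most one clause, or exactly
two clauses whose polarities differ on exactly one variable. -/
def SemisimpleFormula [DecidableEq V] (G : SatFormula V) : Prop :=
  ∀ C₁ ∈ G, ∀ C₂ ∈ G, C₁ ≠ C₂ → clauseVars C₁ = clauseVars C₂ →
    (((C₁ \ C₂).image Prod.fst).card = 1 ∧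
      ∀ C₃ ∈ G, clauseVars C₃ = clauseVars C₁ → C₃ = C₁ ∨ C₃ = C₂)

/-- The type of a (semisimple) formula: an undirected edge on each variable set supporting
exactly one clause, and for each variable set supporting two clauses a directed edge pointed
at the variable where the two clauses differ. -/
def formulaType [DecidableEq V] (G : SatFormula V) : PDG V where
  undir := (G.filter (fun C => ∀ C' ∈ G, clauseVars C' = clauseVars C → C' = C)).image
    clauseVars
  dir := ((G ×ˢ G).filter (fun p => p.1 ≠ p.2 ∧ clauseVars p.1 = clauseVars p.2)).biUnion
    (fun p => ((p.1 \ p.2).image Prod.fst).image (fun v => (clauseVars p.1, v)))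

end Defs

namespace TuranTk

section Flags

variable {V : Type*} [Fintype V] [DecidableEq V]

/-- The vertices extending the set `S` to a member of the family `E`. -/
def extensions (E : Finset (Finset V)) (S : Finset V) : Finset V :=
  Finset.univ.filter fun x => x ∉ S ∧ insert x S ∈ E

theorem mem_extensions {E : Finset (Finset V)} {S : Finset V} {x : V} :
    x ∈ extensions E S ↔ x ∉ S ∧ insert x S ∈ E := by
  simp [extensions]

theorem sum_sum_erase_eq {k : ℕ} {E : Finset (Finset V)} (hE : ∀ e ∈ E, e.card = k + 1)
    (F : Finset V → ℝ) :
    ∑ e ∈ E, ∑ w ∈ e, F (e.erase w) =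
      ∑ S ∈ (Finset.univ : Finset V).powersetCard k, ((extensions E S).card : ℝ) * F S := by
  have h : ∀ S : Finset V, ((extensions E S).card : ℝ) * F S = ∑ _x ∈ extensions E S, F S := by
    intro S
    simp
  simp_rw [h]
  rw [Finset.sum_sigma', Finset.sum_sigma']
  refine Finset.sum_bij' (fun p _ => ⟨p.1.erase p.2, p.2⟩) (fun p _ => ⟨insert p.2 p.1, p.2⟩)
    ?_ ?_ ?_ ?_ ?_
  · rintro ⟨e, w⟩ hp
    simp only [Finset.mem_sigma] at hp
    simp [Finset.mem_powersetCard, mem_extensions, Finset.insert_erase hp.2, hp.1,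
      Finset.card_erase_of_mem hp.2, hE e hp.1]
  · rintro ⟨S, x⟩ hp
    simp only [Finset.mem_sigma, mem_extensions] at hp
    simp [hp.2.2]
  · rintro ⟨e, w⟩ hp
    simp only [Finset.mem_sigma] at hp
    simp [Finset.insert_erase hp.2]
  · rintro ⟨S, x⟩ hp
    simp only [Finset.mem_sigma, mem_extensions] at hp
    simp [Finset.erase_insert hp.2.1]
  · rintro ⟨e, w⟩ _
    rfl

theorem card_extensions_add_card_extensions_compl {k : ℕ} {E : Finset (Finset V)}
    {S : Finset V} (hS : S.card = k) :
    (extensions E S).card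
      + (extensions ((Finset.univ : Finset V).powersetCard (k + 1) \ E) S).card + k =
      Fintype.card V := by
  rw [← Finset.card_union_of_disjoint, ← hS, ← Finset.card_union_of_disjoint, ← Finset.card_univ]
  · congr 1
    ext x
    by_cases hx : x ∈ S
    · simp [hx]
    · simp [hx, mem_extensions, Finset.mem_powersetCard, hS, em]
  · rw [Finset.disjoint_left]
    intro x hx hxS
    simp [mem_extensions, hxS] at hx
  · rw [Finset.disjoint_left]
    intro x hx hx'
    simp only [mem_extensions, Finset.mem_sdiff] at hx hx'
    exact hx'.2.2 hx.2

end Flags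

/-- The pointwise estimate behind the Turán bound: `z` and `y` are the densities of the
codegree opposite the pointed vertex, with and without the pointed vertex itself. -/
theorem edge_charge_bound (k : ℕ) (hk : 2 ≤ k) {z y δ : ℝ} (hz : 0 < z) (hy1 : y < 1)
    (hyz : y = z - δ) (hδ : 0 ≤ δ) :
    6 / 5 - 2 * k * δ ≤
      ((k : ℝ) - 1) / 2 * y + 1 / k * ((1 / z - 1) + (k - 1) * (y / (1 - y))) := by
  have h4 : 4 * y - 1 ≤ y / (1 - y) := by
    rw [le_div_iff₀ (by linarith)]
    nlinarith [sq_nonneg (2 * y - 1)]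
  have h1 : y ≤ y / (1 - y) := by
    rw [le_div_iff₀ (by linarith)]
    nlinarith [sq_nonneg y]
  set q := y / (1 - y)
  have hzz : z * (1 / z) = 1 := by field_simp
  set u := 1 / z
  have hu : 0 < u := by positivity
  obtain rfl | rfl | hk4 : k = 2 ∨ k = 3 ∨ 4 ≤ k := by omega
  · have : 11 / 5 ≤ 5 / 2 * z + u / 2 := by
      by_contra! hc
      nlinarith [mul_lt_mul_of_pos_left hc hz, sq_nonneg (z - 11 / 25)]
    push_cast
    linarith
  · have : 11 / 5 ≤ 11 / 3 * z + u / 3 := by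
      by_contra! hc
      nlinarith [mul_lt_mul_of_pos_left hc hz, sq_nonneg (z - 3 / 10)]
    push_cast
    linarith
  · have hkr : (4 : ℝ) ≤ k := by exact_mod_cast hk4
    set κ : ℝ := (k : ℝ)
    have hκ : 0 < κ := by linarith
    have key : 6 / 5 * κ ≤ (κ - 1) * (κ + 2) / 2 * z + u - 1 := by
      by_contra! hc
      have := mul_lt_mul_of_pos_left hc hz
      have hq : (κ - 1) * (κ + 2) / 2 * z ^ 2 - (6 / 5 * κ + 1) * z + 1 < 0 := by
        nlinarith
      have hP : 0 < (κ - 1) * (κ + 2) := by nlinarith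
      have hd : (6 / 5 * κ + 1) ^ 2 ≤ 2 * ((κ - 1) * (κ + 2)) := by nlinarith
      nlinarith [sq_nonneg ((κ - 1) * (κ + 2) * z - (6 / 5 * κ + 1)),
        mul_lt_mul_of_pos_left hq hP]
    have hmul : (κ - 1) * y ≤ (κ - 1) * q := mul_le_mul_of_nonneg_left h1 (by linarith)
    have : 1 / κ * (6 / 5 * κ - 2 * κ ^ 2 * δ) ≤
        1 / κ * ((κ - 1) / 2 * y * κ + ((u - 1) + (κ - 1) * q)) := by
      apply mul_le_mul_of_nonneg_left _ (by positivity)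
      subst hyz
      have : (κ - 1) * (κ + 2) / 2 * δ ≤ 2 * κ ^ 2 * δ :=
        mul_le_mul_of_nonneg_right (by nlinarith) hδ
      nlinarith
    calc 6 / 5 - 2 * κ * δ = 1 / κ * (6 / 5 * κ - 2 * κ ^ 2 * δ) := by field_simp
      _ ≤ _ := this
      _ = _ := by field_simp

section Counting

variable {V : Type*} [DecidableEq V]

/-- The pointed edges `D` of a uniform family `E` in which every pointed edge has the local
property forced by excluding `T_k`. -/
structure PointedFamily (k : ℕ) (E : Finset (Finset V)) (D : Finset (Finset V × V)) : Prop where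
  card_eq : ∀ e ∈ E, e.card = k + 1
  edge_mem : ∀ p ∈ D, p.1 ∈ E
  point_mem : ∀ p ∈ D, p.2 ∈ p.1
  injOn_fst : Set.InjOn Prod.fst (D : Set (Finset V × V))
  exchange : ∀ p ∈ D, ∀ x ∉ p.1, insert x (p.1.erase p.2) ∈ E →
    ∀ s ∈ p.1, s ≠ p.2 → insert x (p.1.erase s) ∉ E

variable {k : ℕ} {E : Finset (Finset V)} {D : Finset (Finset V × V)}

theorem PointedFamily.erase_notMem (h : PointedFamily k E D) {p : Finset V × V} (hp : p ∈ D)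
    {x : V} (hx : x ∉ p.1) (hxE : insert x (p.1.erase p.2) ∈ E) {w : V}
    (hw : w ∈ insert x p.1) (hwx : w ≠ x) (hwv : w ≠ p.2) : (insert x p.1).erase w ∉ E := by
  rw [Finset.erase_insert_of_ne hwx.symm]
  exact h.exchange p hp x hx hxE w (by simpa [hwx] using hw) hwv

variable [Fintype V]

theorem PointedFamily.extensions_erase_point (h : PointedFamily k E D) {p : Finset V × V}
    (hp : p ∈ D) : extensions E (p.1.erase p.2) =
      insert p.2 (Finset.univ.filter fun x => x ∉ p.1 ∧ insert x (p.1.erase p.2) ∈ E) := by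
  have hv := h.point_mem p hp
  have he := h.edge_mem p hp
  ext x
  by_cases hx : x = p.2
  · subst hx
    simp [mem_extensions, Finset.insert_erase hv, he]
  · simp [mem_extensions, hx]

/-- Each pointed edge `e` with codegree `a` opposite its point yields `(a - 1) k` non-edges. -/
theorem PointedFamily.sum_le_card_compl (h : PointedFamily k E D) :
    ∑ p ∈ D, (((extensions E (p.1.erase p.2)).card : ℝ) - 1) * k ≤
      2 * (Fintype.card V - k : ℝ)
        * ((Finset.univ : Finset V).powersetCard (k + 1) \ E).card := by
  set X : Finset V × V → Finset V :=
    fun p => Finset.univ.filter fun x => x ∉ p.1 ∧ insert x (p.1.erase p.2) ∈ E with hX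
  set C := (Finset.univ : Finset V).powersetCard (k + 1) \ E with hC
  have hXcard : ∀ p ∈ D, (extensions E (p.1.erase p.2)).card = (X p).card + 1 := by
    intro p hp
    rw [h.extensions_erase_point hp, Finset.card_insert_of_notMem]
    simp [h.point_mem p hp]
  have hlhs : ∑ p ∈ D, (((extensions E (p.1.erase p.2)).card : ℝ) - 1) * k =
      ((D.sigma fun p => X p ×ˢ p.1.erase p.2).card : ℝ) := by
    rw [Finset.card_sigma]
    push_cast
    refine Finset.sum_congr rfl fun p hp => ?_
    rw [hXcard p hp, Finset.card_product, Finset.card_erase_of_mem (h.point_mem p hp),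
      h.card_eq _ (h.edge_mem p hp)]
    push_cast
    simp
  have hrhs : (C.sigma fun g => gᶜ).card = C.card * (Fintype.card V - (k + 1)) := by
    rw [Finset.card_sigma]
    refine Finset.sum_const_nat fun g hg => ?_
    rw [Finset.card_compl, (Finset.mem_powersetCard.1 (Finset.mem_sdiff.1 hg).1).2]
  have hmain : (D.sigma fun p => X p ×ˢ p.1.erase p.2).card ≤ 2 * (C.sigma fun g => gᶜ).card := by
    refine Finset.card_le_mul_card_image_of_maps_to
      (f := fun q => ⟨insert q.2.1 (q.1.1.erase q.2.2), q.2.2⟩) ?_ 2 ?_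
    · rintro ⟨⟨e, v⟩, x, s⟩ hq
      simp only [Finset.mem_sigma, Finset.mem_product, hX, Finset.mem_filter, Finset.mem_univ,
        true_and, Finset.mem_erase] at hq
      obtain ⟨hp, ⟨hx, hxE⟩, hsv, hse⟩ := hq
      have hsx : s ≠ x := fun h => hx (h ▸ hse)
      simp only [Finset.mem_sigma, hC, Finset.mem_sdiff, Finset.mem_powersetCard_univ,
        Finset.mem_compl]
      refine ⟨⟨?_, h.exchange _ hp x hx hxE s hse hsv⟩, ?_⟩
      · rw [Finset.card_insert_of_notMem (by simp [hx]), Finset.card_erase_of_mem hse,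
          h.card_eq _ (h.edge_mem _ hp)]
        rfl
      · simp [hsx]
    · rintro ⟨g, s⟩ -
      set T := (D.sigma fun p => X p ×ˢ p.1.erase p.2).filter
        (fun q => (⟨insert q.2.1 (q.1.1.erase q.2.2), q.2.2⟩ : Σ _ : Finset V, V) = ⟨g, s⟩)
        with hT
      have hmem : ∀ q ∈ T, q.1 ∈ D ∧ q.2.1 ∉ q.1.1 ∧
          insert q.2.1 (q.1.1.erase q.1.2) ∈ E ∧ q.2.2 = s ∧
            insert q.2.1 q.1.1 = insert s g := by
        rintro ⟨⟨e, v⟩, x, s'⟩ hq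
        simp only [hT, Finset.mem_filter, Finset.mem_sigma, Finset.mem_product, hX,
          Finset.mem_univ, true_and, Finset.mem_erase, Sigma.mk.injEq, heq_eq_eq] at hq
        obtain ⟨⟨hp, ⟨hx, hxE⟩, hsv, hse⟩, rfl, rfl⟩ := hq
        refine ⟨hp, hx, hxE, rfl, ?_⟩
        rw [Finset.insert_comm, Finset.insert_erase hse]
      rcases T.eq_empty_or_nonempty with hT0 | ⟨⟨⟨e, v⟩, x, s'⟩, hq⟩
      · simp [hT0]
      obtain ⟨hp, hx, hxE, rfl, hK⟩ := hmem _ hq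
      simp only at hp hx hxE hK
      refine (Finset.card_le_card (t := {⟨(e, v), x, s'⟩,
        ⟨((insert x e).erase v, x), v, s'⟩}) ?_).trans Finset.card_le_two
      rintro ⟨⟨e', v'⟩, x', s''⟩ hq'
      obtain ⟨hp', hx', hxE', hs, hK'⟩ := hmem _ hq'
      simp only at hp' hx' hxE' hs hK'
      subst hs
      rw [← hK] at hK'
      have hv' : v' ∈ e' := h.point_mem _ hp'
      have hxv' : x' ≠ v' := fun hh => hx' (hh ▸ hv')
      have hx'2 : x' = x ∨ x' = v := by
        by_contra! hc
        refine h.erase_notMem hp hx hxE (w := x') ?_ hc.1 hc.2 ?_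
        · simp only
          rw [← hK']
          simp
        · simp only
          rw [← hK', Finset.erase_insert hx']
          exact h.edge_mem _ hp'
      have hv'2 : v' = x ∨ v' = v := by
        by_contra! hc
        refine h.erase_notMem hp hx hxE (w := v') ?_ hc.1 hc.2 ?_
        · simp only
          rw [← hK']
          simp [hv']
        · simp only
          rw [← hK', Finset.erase_insert_of_ne hxv']
          exact hxE'
      have he' : e' = (insert x e).erase x' := by
        rw [← hK', Finset.erase_insert hx']
      rcases hx'2 with rfl | rfl <;> rcases hv'2 with rfl | rfl
      · exact absurd rfl hxv'
      · simp [he', Finset.erase_insert hx]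
      · simp [he']
      · exact absurd rfl hxv'
  rw [hlhs]
  have h2 : ((D.sigma fun p => X p ×ˢ p.1.erase p.2).card : ℝ) ≤
      ((2 * (C.card * (Fintype.card V - (k + 1))) : ℕ) : ℝ) := by
    rw [← hrhs]
    exact_mod_cast hmain
  refine h2.trans ?_
  rcases C.eq_empty_or_nonempty with hC0 | ⟨g, hg⟩
  · simp [hC0]
  · have hgk : k + 1 ≤ Fintype.card V := by
      rw [← (Finset.mem_powersetCard.1 (Finset.mem_sdiff.1 hg).1).2]
      exact Finset.card_le_univ g
    push_cast [Nat.cast_sub hgk]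
    nlinarith [Nat.cast_nonneg (α := ℝ) C.card]

/-- Distributing the non-edges at every `k`-set evenly over the edges containing it. -/
theorem PointedFamily.sum_codegree_ratio_le (h : PointedFamily k E D) {N : ℝ}
    (hN : N = Fintype.card V - k) :
    ∑ p ∈ D, ((N - (extensions E (p.1.erase p.2)).card) / (extensions E (p.1.erase p.2)).card
      + k * (((extensions E (p.1.erase p.2)).card - 1)
        / (N - (extensions E (p.1.erase p.2)).card + 1))) ≤
      (k + 1) * (((Finset.univ : Finset V).powersetCard (k + 1) \ E).card : ℝ) := by
  set C := (Finset.univ : Finset V).powersetCard (k + 1) \ E with hC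
  have hcompl : ∀ S : Finset V, S.card = k →
      N - (extensions E S).card = (extensions C S).card := by
    intro S hS
    have := card_extensions_add_card_extensions_compl (E := E) hS
    rw [hN, ← this]
    push_cast
    ring
  have hCcard : ∀ e ∈ C, e.card = k + 1 := fun e he =>
    (Finset.mem_powersetCard.1 (Finset.mem_sdiff.1 he).1).2
  set F : Finset V → ℝ := fun S => (extensions C S).card / (extensions E S).card with hF
  have hF0 : ∀ S, 0 ≤ F S := fun S => by positivity
  have hupper : ∑ e ∈ E, ∑ w ∈ e, F (e.erase w) ≤ (k + 1) * (C.card : ℝ) := by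
    calc ∑ e ∈ E, ∑ w ∈ e, F (e.erase w)
        = ∑ S ∈ (Finset.univ : Finset V).powersetCard k, ((extensions E S).card : ℝ) * F S :=
          sum_sum_erase_eq h.card_eq F
      _ ≤ ∑ S ∈ (Finset.univ : Finset V).powersetCard k, ((extensions C S).card : ℝ) * 1 := by
          refine Finset.sum_le_sum fun S _ => ?_
          rw [mul_one]
          simp only [hF]
          by_cases h0 : ((extensions E S).card : ℝ) = 0
          · simp [h0]
          · rw [mul_div_cancel₀ _ h0]
      _ = ∑ e ∈ C, ∑ w ∈ e, (1 : ℝ) := (sum_sum_erase_eq hCcard fun _ => 1).symm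
      _ = (k + 1) * (C.card : ℝ) := by
          rw [Finset.sum_congr rfl fun e he => by
            rw [Finset.sum_const, hCcard e he, nsmul_eq_mul, mul_one]]
          rw [Finset.sum_const, nsmul_eq_mul]
          push_cast
          ring
  refine le_trans ?_ hupper
  have hsub : ∑ p ∈ D, ∑ w ∈ p.1, F (p.1.erase w) ≤ ∑ e ∈ E, ∑ w ∈ e, F (e.erase w) := by
    rw [← Finset.sum_image (g := Prod.fst) (f := fun e : Finset V => ∑ w ∈ e, F (e.erase w))
      h.injOn_fst]
    refine Finset.sum_le_sum_of_subset_of_nonneg ?_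
      fun e _ _ => Finset.sum_nonneg fun w _ => hF0 _
    intro e he
    obtain ⟨p, hp, rfl⟩ := Finset.mem_image.1 he
    exact h.edge_mem p hp
  refine le_trans (Finset.sum_le_sum fun p hp => ?_) hsub
  obtain ⟨e, v⟩ := p
  have hv : v ∈ e := h.point_mem _ hp
  have he : e ∈ E := h.edge_mem _ hp
  have hcard : ∀ w ∈ e, (e.erase w).card = k := fun w hw => by
    rw [Finset.card_erase_of_mem hw, h.card_eq e he]
    rfl
  rw [← Finset.add_sum_erase _ _ hv]
  refine add_le_add (le_of_eq ?_) ?_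
  · simp only [hF]
    rw [← hcompl _ (hcard v hv)]
  · have hle : ∀ s ∈ e.erase v, ((extensions E (e.erase v)).card - 1 : ℝ)
        / (N - (extensions E (e.erase v)).card + 1) ≤ F (e.erase s) := by
      intro s hs
      obtain ⟨hsv, hse⟩ := Finset.mem_erase.1 hs
      have hpos : 0 < (extensions E (e.erase s)).card := by
        refine Finset.card_pos.2 ⟨s, ?_⟩
        simp [mem_extensions, Finset.insert_erase hse, he]
      have hpos' : 0 < (extensions E (e.erase v)).card := by
        refine Finset.card_pos.2 ⟨v, ?_⟩
        simp [mem_extensions, Finset.insert_erase hv, he]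
      have hsubset : (extensions E (e.erase v)).erase v ⊆ extensions C (e.erase s) := by
        intro x hx
        simp only [Finset.mem_erase, mem_extensions, not_and] at hx
        obtain ⟨hxv, hxe, hxE⟩ := hx
        have hxe' : x ∉ e := fun hh => hxv (by_contra fun hc => (hxe hc) hh)
        simp only [mem_extensions, hC, Finset.mem_sdiff, Finset.mem_powersetCard_univ]
        refine ⟨by simp [hxe'], ?_, h.exchange _ hp x hxe' hxE s hse hsv⟩
        rw [Finset.card_insert_of_notMem (by simp [hxe']), hcard s hse]
      have hnum := Finset.card_le_card hsubset
      rw [Finset.card_erase_of_mem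
        (by simp [mem_extensions, Finset.insert_erase hv, he])] at hnum
      have hnum' : ((extensions E (e.erase v)).card : ℝ) - 1 ≤ (extensions C (e.erase s)).card := by
        have : (extensions E (e.erase v)).card ≤ (extensions C (e.erase s)).card + 1 := by omega
        have : ((extensions E (e.erase v)).card : ℝ) ≤ (extensions C (e.erase s)).card + 1 := by
          exact_mod_cast this
        linarith
      have hs' := hcompl _ (hcard s hse)
      have hone : (1 : ℝ) ≤ (extensions E (e.erase v)).card := by exact_mod_cast hpos'
      have hposr : (0 : ℝ) < (extensions E (e.erase s)).card := by exact_mod_cast hpos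
      exact div_le_div₀ (by positivity) hnum' hposr (by linarith)
    have := Finset.card_nsmul_le_sum _ _ _ hle
    rw [hcard v hv, nsmul_eq_mul] at this
    exact this

theorem PointedFamily.card_add_card_le (h : PointedFamily k E D) (hk : 1 ≤ k)
    (hn : k + 1 ≤ Fintype.card V) :
    (E.card : ℝ) + 3 / 5 * D.card ≤
      (1 + (k + 1) / (Fintype.card V - k)) * (Fintype.card V).choose (k + 1) := by
  set N : ℝ := Fintype.card V - k with hN
  set C := (Finset.univ : Finset V).powersetCard (k + 1) \ E with hC
  have hN1 : 1 ≤ N := by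
    have : ((k + 1 : ℕ) : ℝ) ≤ Fintype.card V := by exact_mod_cast hn
    push_cast at this
    linarith
  have hsubE : E ⊆ (Finset.univ : Finset V).powersetCard (k + 1) := fun e he =>
    Finset.mem_powersetCard_univ.2 (h.card_eq e he)
  have hEC : (E.card : ℝ) + C.card = (Fintype.card V).choose (k + 1) := by
    have := Finset.card_sdiff_add_card_eq_card hsubE
    rw [Finset.card_powersetCard, Finset.card_univ] at this
    rw [← this]
    push_cast
    ring
  have hDE : (D.card : ℝ) ≤ (Fintype.card V).choose (k + 1) := by
    have : D.card ≤ E.card := Finset.card_le_card_of_injOn _ h.edge_mem h.injOn_fst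
    have : (D.card : ℝ) ≤ E.card := by exact_mod_cast this
    have : (0 : ℝ) ≤ C.card := by positivity
    linarith
  have h1 := h.sum_le_card_compl
  have h2 := h.sum_codegree_ratio_le hN
  rw [← hN, ← hC] at h1
  rw [← hC] at h2
  have hpt : ∀ p ∈ D, 6 / 5 - 2 * ((k + 1 : ℕ) : ℝ) * (1 / N) ≤
      (((extensions E (p.1.erase p.2)).card : ℝ) - 1) * k * (1 / (2 * N)) +
      ((N - (extensions E (p.1.erase p.2)).card) / (extensions E (p.1.erase p.2)).card
      + k * (((extensions E (p.1.erase p.2)).card - 1)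
        / (N - (extensions E (p.1.erase p.2)).card + 1))) * (1 / (k + 1)) := by
    intro p hp
    have hA : (0 : ℝ) < (extensions E (p.1.erase p.2)).card := by
      have : 0 < (extensions E (p.1.erase p.2)).card := by
        rw [h.extensions_erase_point hp]
        exact Finset.card_pos.2 (Finset.insert_nonempty _ _)
      exact_mod_cast this
    have hAN : ((extensions E (p.1.erase p.2)).card : ℝ) ≤ N := by
      have hcard : (p.1.erase p.2).card = k := by
        rw [Finset.card_erase_of_mem (h.point_mem p hp), h.card_eq _ (h.edge_mem p hp)]
        rfl
      have := card_extensions_add_card_extensions_compl (E := E) hcard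
      have : (extensions E (p.1.erase p.2)).card + k ≤ Fintype.card V := by omega
      have : ((extensions E (p.1.erase p.2)).card : ℝ) + k ≤ Fintype.card V := by
        exact_mod_cast this
      linarith
    set A : ℝ := ((extensions E (p.1.erase p.2)).card : ℝ)
    have hN0 : 0 < N := by linarith
    have hy : (A - 1) / N < 1 := by
      rw [div_lt_one hN0]
      linarith
    refine (edge_charge_bound (k + 1) (by omega) (z := A / N) (y := (A - 1) / N) (δ := 1 / N)
      (by positivity) hy (sub_div _ _ _) (by positivity)).trans (le_of_eq ?_)
    have hq : (A - 1) / N / (1 - (A - 1) / N) = (A - 1) / (N - A + 1) := by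
      have : 1 - (A - 1) / N = (N - A + 1) / N := by
        field_simp
        ring
      rw [this, div_div_div_cancel_right₀ hN0.ne']
    rw [hq]
    have hz : 1 / (A / N) - 1 = (N - A) / A := by field_simp
    rw [hz]
    clear_value N A
    push_cast
    ring
  have hsum := Finset.card_nsmul_le_sum _ _ _ hpt
  rw [Finset.sum_add_distrib, ← Finset.sum_mul (a := 1 / (2 * N)),
    ← Finset.sum_mul (a := 1 / ((k : ℝ) + 1)), nsmul_eq_mul] at hsum
  have hN0 : 0 < N := by linarith
  have h1' := mul_le_mul_of_nonneg_right h1 (by positivity : 0 ≤ 1 / (2 * N))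
  have h2' := mul_le_mul_of_nonneg_right h2 (by positivity : 0 ≤ 1 / ((k : ℝ) + 1))
  have e1 : 2 * N * (C.card : ℝ) * (1 / (2 * N)) = C.card := by field_simp
  have e2 : ((k : ℝ) + 1) * C.card * (1 / (k + 1)) = C.card := by field_simp
  rw [e1] at h1'
  rw [e2] at h2'
  have h3 : ((k : ℝ) + 1) / N * D.card ≤ (k + 1) / N * (Fintype.card V).choose (k + 1) :=
    mul_le_mul_of_nonneg_left hDE (by positivity)
  have h4 : (D.card : ℝ) * (6 / 5 - 2 * ((k + 1 : ℕ) : ℝ) * (1 / N)) =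
      6 / 5 * D.card - 2 * ((k + 1) / N * D.card) := by
    push_cast
    ring
  rw [h4] at hsum
  linarith

end Counting

section Hypergraph

variable {V : Type*} [DecidableEq V]

/-- The underlying family of edges of a partially directed graph. -/
def edges (H : PDG V) : Finset (Finset V) := H.undir ∪ H.dir.image Prod.fst

theorem mem_edges {H : PDG V} {e : Finset V} :
    e ∈ edges H ↔ e ∈ H.undir ∨ ∃ v, (e, v) ∈ H.dir := by
  simp [edges]

theorem isSubgraph_TkPDG {k : ℕ} {H : PDG V} (hk : 2 ≤ k) {e : Finset V} {v x s : V}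
    (he : e.card = k) (hp : (e, v) ∈ H.dir) (hv : v ∈ e) (hx : x ∉ e) (hs : s ∈ e) (hsv : s ≠ v)
    (hxv : insert x (e.erase v) ∈ edges H) (hxs : insert x (e.erase s) ∈ edges H) :
    (TkPDG k).IsSubgraph H := by
  have hxv' : x ≠ v := fun h => hx (h ▸ hv)
  have hxs' : x ≠ s := fun h => hx (h ▸ hs)
  set i₀ : Fin (k + 1) := ⟨k - 2, by omega⟩ with hi₀
  set i₁ : Fin (k + 1) := ⟨k - 1, by omega⟩ with hi₁
  set i₂ : Fin (k + 1) := ⟨k, by omega⟩ with hi₂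
  have h01 : i₀ ≠ i₁ := by simp [hi₀, hi₁, Fin.ext_iff]; omega
  have h02 : i₀ ≠ i₂ := by simp [hi₀, hi₂, Fin.ext_iff]; omega
  have h12 : i₁ ≠ i₂ := by simp [hi₁, hi₂, Fin.ext_iff]; omega
  set f : Fin (k + 1) → V := fun i => if i = i₂ then v else if i = i₁ then x else s with hf
  have f0 : f i₀ = s := by simp [hf, h01, h02]
  have f1 : f i₁ = x := by simp [hf, h12]
  have f2 : f i₂ = v := by simp [hf]
  obtain ⟨g, hg⟩ := Finset.exists_equiv_extend_of_card_eq (α := Fin (k + 1)) (t := insert x e)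
    (by rw [Finset.card_insert_of_notMem hx, he, Fintype.card_fin])
    (s := {i₀, i₁, i₂}) (f := f)
    (by
      intro y hy
      simp only [Finset.mem_image, Finset.mem_insert, Finset.mem_singleton] at hy
      obtain ⟨i, rfl | rfl | rfl, rfl⟩ := hy <;> simp [f0, f1, f2, hv, hs])
    (by
      intro a ha b hb hab
      simp only [Finset.coe_insert, Finset.coe_singleton, Set.mem_insert_iff,
        Set.mem_singleton_iff] at ha hb
      rcases ha with rfl | rfl | rfl <;> rcases hb with rfl | rfl | rfl <;>
        simp_all)
  have g0 : (g i₀ : V) = s := by rw [hg _ (by simp), f0]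
  have g1 : (g i₁ : V) = x := by rw [hg _ (by simp), f1]
  have g2 : (g i₂ : V) = v := by rw [hg _ (by simp), f2]
  have hinj : Function.Injective fun i => (g i : V) :=
    Subtype.val_injective.comp g.injective
  have himg : Finset.univ.image (fun i => (g i : V)) = insert x e := by
    ext y
    simp only [Finset.mem_image, Finset.mem_univ, true_and]
    constructor
    · rintro ⟨i, rfl⟩
      exact (g i).2
    · intro hy
      exact ⟨g.symm ⟨y, hy⟩, by simp⟩
  refine ⟨fun i => g i, hinj, ?_, ?_⟩
  · intro a ha
    rw [← mem_edges]
    simp only [TkPDG, Finset.mem_insert, Finset.mem_singleton] at ha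
    rcases ha with rfl | rfl
    · rw [Finset.image_erase hinj, himg, g2, Finset.erase_insert_of_ne hxv']
      exact hxv
    · rw [Finset.image_erase hinj, himg, g0, Finset.erase_insert_of_ne hxs']
      exact hxs
  · intro p hp'
    simp only [TkPDG, Finset.mem_singleton] at hp'
    subst hp'
    simp only
    rw [Finset.image_erase hinj, himg, g1, g2, Finset.erase_insert hx]
    exact hp

theorem pointedFamily_of_free {k : ℕ} (hk : 1 ≤ k) {H : PDG V} [Fintype V]
    (hH : H.IsValid (k + 1)) (hfree : ¬ (TkPDG (k + 1)).IsSubgraph H) :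
    PointedFamily k (edges H) H.dir where
  card_eq e he := by
    rcases mem_edges.1 he with h | ⟨v, h⟩
    · exact hH.1 e h
    · exact (hH.2.1 _ h).1
  edge_mem p hp := mem_edges.2 (Or.inr ⟨p.2, hp⟩)
  point_mem p hp := (hH.2.1 p hp).2
  injOn_fst p hp q hq hpq := hH.2.2.2 p hp q hq hpq
  exchange p hp _ hx hxE _ hs hsv hsE := hfree
    (isSubgraph_TkPDG (by omega) (hH.2.1 p hp).1 hp (hH.2.1 p hp).2 hx hs hsv hxE hsE)

theorem card_edges {k : ℕ} {H : PDG V} (hH : H.IsValid k) :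
    (edges H).card = H.undir.card + H.dir.card := by
  rw [edges, Finset.card_union_of_disjoint, Finset.card_image_of_injOn]
  · exact fun p hp q hq hpq => hH.2.2.2 p hp q hq hpq
  · rw [Finset.disjoint_right]
    intro e he
    obtain ⟨p, hp, rfl⟩ := Finset.mem_image.1 he
    exact hH.2.2.1 p hp

end Hypergraph

theorem logb_two_three_lt : Real.logb 2 3 < 8 / 5 := by
  rw [Real.logb_lt_iff_lt_rpow (by norm_num) (by norm_num)]
  refine lt_of_pow_lt_pow_left₀ 5 (by positivity) ?_
  rw [← Real.rpow_mul_natCast (by norm_num)]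
  norm_num

end TuranTk

/-- For every `k ≥ 2` there is `θ > log₂ 3` such that for every `ε > 0`
there is `n₀` with: every `T_k`-free `k`-PDG `H` on `n ≥ n₀` vertices satisfies
`e_u(H) + θ·e_d(H) ≤ (1+ε)·C(n,k)`. -/
theorem turan_Tk (k : ℕ) (hk : 2 ≤ k) :
    ∃ θ : ℝ, Real.logb 2 3 < θ ∧
      ∀ ε : ℝ, 0 < ε → ∃ n₀ : ℕ, ∀ n ≥ n₀, ∀ H : PDG (Fin n),
        H.IsValid k → ¬ (TkPDG k).IsSubgraph H →
        (H.undir.card : ℝ) + θ * H.dir.card ≤ (1 + ε) * n.choose k := by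
  obtain ⟨m, rfl⟩ : ∃ m, k = m + 1 := ⟨k - 1, by omega⟩
  refine ⟨8 / 5, TuranTk.logb_two_three_lt, fun ε hε => ?_⟩
  refine ⟨m + 1 + ⌈((m : ℝ) + 1) / ε⌉₊, fun n hn H hH hfree => ?_⟩
  have hF := TuranTk.pointedFamily_of_free (by omega) hH hfree
  have hmain := hF.card_add_card_le (by omega) (by rw [Fintype.card_fin]; omega)
  rw [TuranTk.card_edges hH, Fintype.card_fin] at hmain
  push_cast at hmain
  have hn' : (m : ℝ) + 1 + ((m : ℝ) + 1) / ε ≤ n := by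
    have h1 : ((m + 1 + ⌈((m : ℝ) + 1) / ε⌉₊ : ℕ) : ℝ) ≤ n := by exact_mod_cast hn
    push_cast at h1
    linarith [Nat.le_ceil (((m : ℝ) + 1) / ε)]
  have hpos : 0 ≤ ((m : ℝ) + 1) / ε := by positivity
  have hε' : ((m : ℝ) + 1) / (n - m) ≤ ε := by
    rw [div_le_comm₀ (by linarith) hε]
    linarith
  have hchoose : (1 + ((m : ℝ) + 1) / (n - m)) * n.choose (m + 1) ≤
      (1 + ε) * n.choose (m + 1) :=
    mul_le_mul_of_nonneg_right (by linarith) (by positivity)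
  linarith
end

section
/- Let k ≥ 2 be an integer. For every ε > 0 there exists n₀ such that for all n ≥ n₀, the number of k-SAT functions on n Boolean variables is at most 2^{(π(T_k, log₂3) + ε)·C(n,k)}, where π(T_k, θ) is the infimum of all reals p such that for every δ > 0 there exists N with: every T_k-free partially directed k-graph H on n ≥ N vertices satisfies e_u(H) + θ·e_d(H) ≤ (p+δ)·C(n,k). -/
/-- The Turán density `π(T_k, θ)`: the infimum of all `p` such that for every `δ > 0`, all
sufficiently large `T_k`-free `k`-PDGs `H` satisfy `e_u(H) + θ·e_d(H) ≤ (p+δ)·C(n,k)`. -/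
noncomputable def piTuran (k : ℕ) (θ : ℝ) : ℝ :=
  sInf {p : ℝ | ∀ δ : ℝ, 0 < δ → ∃ N : ℕ, ∀ n ≥ N, ∀ H : PDG (Fin n),
    H.IsValid k → ¬ (TkPDG k).IsSubgraph H →
    (H.undir.card : ℝ) + θ * H.dir.card ≤ (p + δ) * n.choose k}

section Counting

open Finset

/-- Summing a weight on `k`-sets over all `l`-sets counts each `k`-set equally often. -/
lemma sum_powersetCard_powersetCard {V : Type*} [DecidableEq V] {k l : ℕ} (hkl : k ≤ l)
    (M : Finset V) (g : Finset V → ℝ) :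
    ∑ M₀ ∈ M.powersetCard l, ∑ S ∈ M₀.powersetCard k, g S =
      ((#M - k).choose (l - k) : ℝ) * ∑ S ∈ M.powersetCard k, g S := by
  have h : ∑ M₀ ∈ M.powersetCard l, ∑ S ∈ M₀.powersetCard k, g S =
      ∑ S ∈ M.powersetCard k, ∑ M₀ ∈ (M.powersetCard l).filter (S ⊆ ·), g S := by
    apply sum_comm'
    intro M₀ S
    simp only [mem_powersetCard, mem_filter]
    constructor
    · rintro ⟨⟨h1, h2⟩, h3, h4⟩
      exact ⟨⟨⟨h1, h2⟩, h3⟩, h3.trans h1, h4⟩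
    · rintro ⟨⟨⟨h1, h2⟩, h3⟩, -, h4⟩
      exact ⟨⟨h1, h2⟩, h3, h4⟩
  rw [h, mul_sum]
  apply sum_congr rfl
  intro S hS
  rw [mem_powersetCard] at hS
  rw [sum_const, card_filter_powersetCard_subset S M l hS.1 (hS.2 ▸ hkl), hS.2, nsmul_eq_mul]

lemma pow_le_mul_choose {m k : ℕ} (h : 2 * k ≤ m) :
    (m : ℝ) ^ k ≤ (2 ^ k * k.factorial : ℝ) * m.choose k := by
  have h1 := Nat.pow_sub_le_descFactorial m k
  rw [Nat.descFactorial_eq_factorial_mul_choose] at h1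
  have h2 : m ^ k ≤ 2 ^ k * (m + 1 - k) ^ k := by
    rw [← mul_pow]
    exact Nat.pow_le_pow_left (by omega) _
  have h3 : m ^ k ≤ 2 ^ k * (k.factorial * m.choose k) :=
    h2.trans (Nat.mul_le_mul_left _ h1)
  rw [mul_assoc]
  exact_mod_cast h3

lemma choose_le_two_pow_mul_choose {n k w : ℕ} (h : 2 * (k + w) ≤ n) :
    (n.choose w : ℝ) ≤ 2 ^ w * (n - k).choose w := by
  have h1 := Nat.pow_sub_le_descFactorial (n - k) w
  have h2 := Nat.descFactorial_le_pow n w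
  rw [Nat.descFactorial_eq_factorial_mul_choose] at h1 h2
  have h3 : n ^ w ≤ 2 ^ w * (n - k + 1 - w) ^ w := by
    rw [← mul_pow]
    exact Nat.pow_le_pow_left (by omega) _
  have h4 : w.factorial * n.choose w ≤ w.factorial * (2 ^ w * (n - k).choose w) := by
    calc _ ≤ _ := h2
      _ ≤ _ := h3
      _ ≤ 2 ^ w * (w.factorial * (n - k).choose w) := Nat.mul_le_mul_left _ h1
      _ = _ := by ring
  exact_mod_cast Nat.le_of_mul_le_mul_left h4 (Nat.factorial_pos w)

/-- A dense set of tuples contains a nondegenerate combinatorial box. -/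
lemma exists_box (r : ℕ) : ∀ δ : ℝ, 0 < δ → ∃ N : ℕ, ∀ (V : Type) [DecidableEq V]
    (M : Finset V) (E : Finset (Fin r → V)), N ≤ #M → (∀ f ∈ E, ∀ i, f i ∈ M) →
    δ * (#M : ℝ) ^ r ≤ #E →
    ∃ x y : Fin r → V, (∀ i, x i ≠ y i) ∧ ∀ u : Fin r → V, (∀ i, u i = x i ∨ u i = y i) → u ∈ E := by
  induction r with
  | zero =>
    intro δ hδ
    refine ⟨0, fun V _ M E _ _ hE => ?_⟩
    have hE' : 0 < (#E : ℝ) := lt_of_lt_of_le (by simpa using hδ) hE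
    obtain ⟨f, hf⟩ := card_pos.1 (by exact_mod_cast hE')
    exact ⟨f, f, fun i => i.elim0, fun u _ => by rwa [Subsingleton.elim u f]⟩
  | succ r ih =>
    intro δ hδ
    obtain ⟨N, hN⟩ := ih (δ ^ 2 / 2) (by positivity)
    obtain ⟨N', hN'⟩ := exists_nat_gt (2 / δ ^ 2)
    refine ⟨max N (max N' 1), fun V _ M E hM hEM hE => ?_⟩
    have hM1 : N ≤ #M := le_trans (le_max_left _ _) hM
    have hM2 : N' ≤ #M := le_trans ((le_max_left _ _).trans (le_max_right _ _)) hM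
    have hM3 : 1 ≤ #M := le_trans ((le_max_right _ _).trans (le_max_right _ _)) hM
    set K : Finset (Fin r → V) := Fintype.piFinset (fun _ : Fin r => M) with hK
    have hKc : (#K : ℝ) = (#M : ℝ) ^ r := by
      rw [hK, Fintype.card_piFinset]; simp
    let I : V → (Fin r → V) → ℝ := fun v f => if (Fin.cons v f : Fin (r + 1) → V) ∈ E then 1 else 0
    have hsum : ∑ f ∈ K, ∑ v ∈ M, I v f = #E := by
      rw [← sum_product']
      have : ∑ x ∈ K ×ˢ M, I x.2 x.1 =
          #((K ×ˢ M).filter (fun x => (Fin.cons x.2 x.1 : Fin (r + 1) → V) ∈ E)) := by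
        simp [I]
      rw [this]
      norm_cast
      refine card_bij (fun x _ => (Fin.cons x.2 x.1 : Fin (r + 1) → V)) ?_ ?_ ?_
      · intro x hx
        exact (mem_filter.1 hx).2
      · rintro ⟨a, b⟩ _ ⟨a', b'⟩ _ h
        have := Fin.cons_inj.1 h
        exact Prod.ext this.2 this.1
      · intro f hf
        refine ⟨(Fin.tail f, f 0), ?_, by simp⟩
        simp only [mem_filter, mem_product, Fin.cons_self_tail, hf, and_true]
        exact ⟨Fintype.mem_piFinset.2 fun i => hEM f hf _, hEM f hf _⟩
    have hcs := sq_sum_le_card_mul_sum_sq (s := K) (f := fun f => ∑ v ∈ M, I v f)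
    rw [hsum, hKc] at hcs
    have hexp : ∑ f ∈ K, (∑ v ∈ M, I v f) ^ 2 = ∑ u ∈ M, ∑ v ∈ M, ∑ f ∈ K, I u f * I v f := by
      simp_rw [sq, sum_mul_sum]
      rw [sum_comm]
      apply sum_congr rfl
      intro u _
      rw [sum_comm]
    rw [hexp] at hcs
    have hmpos : (0 : ℝ) < #M := by exact_mod_cast hM3
    by_contra hcon
    have hoff : ∀ u ∈ M, ∀ v ∈ M, u ≠ v →
        ∑ f ∈ K, I u f * I v f ≤ δ ^ 2 / 2 * (#M : ℝ) ^ r := by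
      intro u hu v hv huv
      by_contra hlt
      push Not at hlt
      set E' : Finset (Fin r → V) := K.filter (fun f =>
        (Fin.cons u f : Fin (r + 1) → V) ∈ E ∧ (Fin.cons v f : Fin (r + 1) → V) ∈ E) with hE'
      have hcard : ∑ f ∈ K, I u f * I v f = #E' := by
        rw [hE', card_filter]
        push_cast
        apply sum_congr rfl
        intro f _
        by_cases h1 : (Fin.cons u f : Fin (r + 1) → V) ∈ E <;>
          by_cases h2 : (Fin.cons v f : Fin (r + 1) → V) ∈ E <;> simp [I, h1, h2]
      rw [hcard] at hlt
      obtain ⟨x, y, hxy, hbox⟩ := hN V M E' hM1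
        (fun f hf i => Fintype.mem_piFinset.1 (mem_filter.1 hf).1 i) hlt.le
      refine hcon ⟨Fin.cons u x, Fin.cons v y, ?_, ?_⟩
      · intro i
        refine Fin.cases ?_ (fun j => ?_) i
        · simpa using huv
        · simpa using hxy j
      · intro z hz
        have hz0 := hz 0
        have hzt : Fin.tail z ∈ E' := hbox _ (fun i => by simpa [Fin.tail] using hz i.succ)
        have hzt' := (mem_filter.1 hzt).2
        simp only [Fin.cons_zero] at hz0
        rw [← Fin.cons_self_tail z]
        rcases hz0 with h | h
        · rw [h]; exact hzt'.1
        · rw [h]; exact hzt'.2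
    have hdiag : ∀ u v : V, ∑ f ∈ K, I u f * I v f ≤ (#M : ℝ) ^ r := by
      intro u v
      rw [← hKc, card_eq_sum_ones]
      push_cast
      apply sum_le_sum
      intro f _
      simp only [I]
      split_ifs <;> simp
    have htot : ∑ u ∈ M, ∑ v ∈ M, ∑ f ∈ K, I u f * I v f ≤
        ∑ u ∈ M, ∑ v ∈ M, (δ ^ 2 / 2 * (#M : ℝ) ^ r + if u = v then (#M : ℝ) ^ r else 0) := by
      apply sum_le_sum; intro u hu
      apply sum_le_sum; intro v hv
      split_ifs with h
      · have : 0 ≤ δ ^ 2 / 2 * (#M : ℝ) ^ r := by positivity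
        linarith [hdiag u v]
      · simpa using hoff u hu v hv h
    have heval : ∑ u ∈ M, ∑ v ∈ M, (δ ^ 2 / 2 * (#M : ℝ) ^ r + if u = v then (#M : ℝ) ^ r else 0)
        = (#M : ℝ) ^ r * (δ ^ 2 / 2 * (#M : ℝ) ^ 2 + #M) := by
      simp only [sum_add_distrib, sum_const, nsmul_eq_mul, sum_ite_eq]
      simp
      ring
    rw [heval] at htot
    have hE2 : (δ * (#M : ℝ) ^ (r + 1)) ^ 2 ≤ (#E : ℝ) ^ 2 := by
      apply pow_le_pow_left₀ (by positivity) hE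
    have hfin : (δ * (#M : ℝ) ^ (r + 1)) ^ 2 ≤
        (#M : ℝ) ^ r * ((#M : ℝ) ^ r * (δ ^ 2 / 2 * (#M : ℝ) ^ 2 + #M)) :=
      hE2.trans (hcs.trans (by gcongr))
    have h5 : ((#M : ℝ) ^ r * (#M : ℝ) ^ r * #M) * (δ ^ 2 * #M) ≤
        ((#M : ℝ) ^ r * (#M : ℝ) ^ r * #M) * (δ ^ 2 / 2 * #M + 1) := by
      calc _ = (δ * (#M : ℝ) ^ (r + 1)) ^ 2 := by ring
        _ ≤ _ := hfin
        _ = _ := by ring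
    have h6 := le_of_mul_le_mul_left h5 (by positivity)
    have h7 : (2 / δ ^ 2 : ℝ) < #M := hN'.trans_le (by exact_mod_cast hM2)
    rw [div_lt_iff₀ (by positivity)] at h7
    linarith

end Counting

section Turan

open Finset

/-- `p` is an asymptotic upper bound for the weighted density of `T_k`-free `k`-PDGs. -/
def TuranBound (k : ℕ) (θ p : ℝ) : Prop :=
  ∀ δ : ℝ, 0 < δ → ∃ N : ℕ, ∀ n ≥ N, ∀ H : PDG (Fin n),
    H.IsValid k → ¬ (TkPDG k).IsSubgraph H →
    (H.undir.card : ℝ) + θ * H.dir.card ≤ (p + δ) * n.choose k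

lemma TuranBound.nonneg {k : ℕ} {θ p : ℝ} (h : TuranBound k θ p) : 0 ≤ p := by
  by_contra hp
  push Not at hp
  obtain ⟨N, hN⟩ := h (-p / 2) (by linarith)
  have := hN (max N k) (le_max_left _ _) ⟨∅, ∅⟩ (by simp [PDG.IsValid]) (by
    rintro ⟨φ, -, -, h⟩
    have := h _ (mem_singleton_self _)
    simp at this)
  have hc : (0 : ℝ) < ((max N k).choose k : ℕ) := by
    exact_mod_cast Nat.choose_pos (le_max_right _ _)
  simp only [card_empty, Nat.cast_zero, mul_zero, add_zero] at this
  nlinarith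

lemma exists_turanBound_lt (k : ℕ) {θ ε : ℝ} (hθ : 0 ≤ θ) (hε : 0 < ε) :
    ∃ p, TuranBound k θ p ∧ p < piTuran k θ + ε := by
  have hne : {p : ℝ | TuranBound k θ p}.Nonempty := by
    refine ⟨1 + θ, fun δ hδ => ⟨0, fun n _ H hH _ => ?_⟩⟩
    have h1 : #H.undir ≤ n.choose k := by
      have : H.undir ⊆ powersetCard k univ := fun e he =>
        mem_powersetCard.2 ⟨subset_univ _, hH.1 e he⟩
      simpa using card_le_card this
    have h2 : #H.dir ≤ n.choose k := by
      have : #H.dir ≤ #(powersetCard k (univ : Finset (Fin n))) :=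
        card_le_card_of_injOn Prod.fst
          (fun q hq => mem_powersetCard.2 ⟨subset_univ _, (hH.2.1 q hq).1⟩)
          (fun q hq q' hq' h => hH.2.2.2 q hq q' hq' h)
      simpa using this
    have h1' : (#H.undir : ℝ) ≤ n.choose k := by exact_mod_cast h1
    have h2' : (#H.dir : ℝ) ≤ n.choose k := by exact_mod_cast h2
    have h3 : (0 : ℝ) ≤ n.choose k := by positivity
    nlinarith [mul_le_mul_of_nonneg_left h2' hθ]
  obtain ⟨p, hp, hlt⟩ := exists_lt_of_csInf_lt (s := {p : ℝ | TuranBound k θ p}) hne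
    (show sInf {p : ℝ | TuranBound k θ p} < piTuran k θ + ε by
      change piTuran k θ < _
      linarith)
  exact ⟨p, hp, hlt⟩

/-- `φ` embeds `T_k` into `H`. -/
def TkEmbeds {V : Type*} [DecidableEq V] (k : ℕ) (H : PDG V) (φ : Fin (k + 1) → V) : Prop :=
  Function.Injective φ ∧
    (∀ e ∈ (TkPDG k).undir, e.image φ ∈ H.undir ∨ ∃ v, (e.image φ, v) ∈ H.dir) ∧
    (∀ p ∈ (TkPDG k).dir, (p.1.image φ, φ p.2) ∈ H.dir)

open Classical in
/-- The `(k+1)`-subsets of `M` spanning a copy of `T_k`. -/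
noncomputable def tkSets {V : Type*} [DecidableEq V] (k : ℕ) (H : PDG V) (M : Finset V) :
    Finset (Finset V) :=
  (M.powersetCard (k + 1)).filter (fun T => ∃ φ, TkEmbeds k H φ ∧ univ.image φ = T)

/-- The contribution of a `k`-set to the weight of a PDG. -/
noncomputable def pdgWeight {V : Type*} [DecidableEq V] (θ : ℝ) (H : PDG V) (S : Finset V) : ℝ :=
  (if S ∈ H.undir then 1 else 0) + θ * #(H.dir.filter (fun q => q.1 = S))

lemma sum_pdgWeight {V : Type*} [DecidableEq V] (θ : ℝ) (H : PDG V) (A : Finset (Finset V)) :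
    ∑ S ∈ A, pdgWeight θ H S =
      #(H.undir.filter (· ∈ A)) + θ * #(H.dir.filter (fun q => q.1 ∈ A)) := by
  unfold pdgWeight
  rw [sum_add_distrib, ← mul_sum]
  congr 1
  · rw [sum_boole]
    congr 2
    ext S
    simp [and_comm]
  · congr 1
    rw [← Nat.cast_sum, card_eq_sum_card_fiberwise (s := H.dir.filter (fun q => q.1 ∈ A)) (t := A)
      (f := Prod.fst) (fun q hq => (mem_filter.1 hq).2)]
    congr 1
    apply sum_congr rfl
    intro S hS
    congr 1
    ext q
    simp only [mem_filter]
    constructor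
    · rintro ⟨h, rfl⟩; exact ⟨⟨h, hS⟩, rfl⟩
    · rintro ⟨⟨h, -⟩, rfl⟩; exact ⟨h, rfl⟩

lemma sum_pdgWeight_le_of_tkFree {V : Type*} [DecidableEq V] {k : ℕ} {θ b : ℝ} {H : PDG V}
    (hH : H.IsValid k) {M : Finset V}
    (hb : ∀ H : PDG (Fin #M), H.IsValid k → ¬ (TkPDG k).IsSubgraph H →
      (H.undir.card : ℝ) + θ * H.dir.card ≤ b)
    (hfree : ∀ φ, TkEmbeds k H φ → ¬ univ.image φ ⊆ M) :
    ∑ S ∈ M.powersetCard k, pdgWeight θ H S ≤ b := by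
  let e : Fin #M ↪ V := M.equivFin.symm.toEmbedding.trans (Function.Embedding.subtype _)
  have heM : ∀ i, e i ∈ M := fun i => (M.equivFin.symm i).2
  have hsurj : ∀ v ∈ M, ∃ i, e i = v := fun v hv =>
    ⟨M.equivFin ⟨v, hv⟩, by simp [e]⟩
  have hmap : ∀ S : Finset V, S ⊆ M → ∃ s : Finset (Fin #M), s.map e = S := by
    intro S hS
    refine ⟨univ.filter (fun i => e i ∈ S), ?_⟩
    ext v
    simp only [mem_map, mem_filter, mem_univ, true_and]
    constructor
    · rintro ⟨i, hi, rfl⟩; exact hi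
    · intro hv
      obtain ⟨i, rfl⟩ := hsurj v (hS hv)
      exact ⟨i, hv, rfl⟩
  let H' : PDG (Fin #M) := ⟨univ.filter (fun s => s.map e ∈ H.undir),
    univ.filter (fun q => (q.1.map e, e q.2) ∈ H.dir)⟩
  have hvalid : H'.IsValid k := by
    refine ⟨?_, ?_, ?_, ?_⟩
    · intro s hs
      have := hH.1 _ (mem_filter.1 hs).2
      simpa using this
    · intro q hq
      have := hH.2.1 _ (mem_filter.1 hq).2
      simpa using this
    · intro q hq h
      exact hH.2.2.1 _ (mem_filter.1 hq).2 (mem_filter.1 h).2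
    · intro q hq q' hq' h
      have := hH.2.2.2 _ (mem_filter.1 hq).2 _ (mem_filter.1 hq').2 (by rw [h])
      simp only [Prod.mk.injEq] at this
      exact Prod.ext h (e.injective this.2)
  have hsub : ¬ (TkPDG k).IsSubgraph H' := by
    rintro ⟨φ, hφ, h1, h2⟩
    refine hfree (e ∘ φ) ⟨e.injective.comp hφ, ?_, ?_⟩ ?_
    · intro s hs
      have h := h1 s hs
      rw [← image_image, ← map_eq_image]
      rcases h with h | ⟨v, h⟩
      · exact Or.inl (mem_filter.1 h).2
      · exact Or.inr ⟨_, (mem_filter.1 h).2⟩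
    · intro q hq
      have h := (mem_filter.1 (h2 q hq)).2
      rw [← image_image, ← map_eq_image]
      exact h
    · intro v hv
      obtain ⟨i, -, rfl⟩ := mem_image.1 hv
      exact heM _
  have hle := hb H' hvalid hsub
  rw [sum_pdgWeight]
  convert hle using 2
  · norm_cast
    symm
    refine card_bij (fun s _ => s.map e) ?_ ?_ ?_
    · intro s hs
      have h := (mem_filter.1 hs).2
      refine mem_filter.2 ⟨h, mem_powersetCard.2 ⟨?_, hH.1 _ h⟩⟩
      intro v hv
      obtain ⟨i, -, rfl⟩ := mem_map.1 hv
      exact heM i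
    · intro s _ s' _ h
      exact map_injective e h
    · intro S hS
      have hS' := mem_filter.1 hS
      obtain ⟨s, rfl⟩ := hmap S (mem_powersetCard.1 hS'.2).1
      exact ⟨s, mem_filter.2 ⟨mem_univ _, hS'.1⟩, rfl⟩
  · congr 1
    norm_cast
    symm
    refine card_bij (fun q _ => (q.1.map e, e q.2)) ?_ ?_ ?_
    · intro q hq
      have h := (mem_filter.1 hq).2
      refine mem_filter.2 ⟨h, mem_powersetCard.2 ⟨?_, (hH.2.1 _ h).1⟩⟩
      intro v hv
      obtain ⟨i, -, rfl⟩ := mem_map.1 hv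
      exact heM i
    · intro q _ q' _ h
      simp only [Prod.mk.injEq] at h
      exact Prod.ext (map_injective e h.1) (e.injective h.2)
    · rintro ⟨S, v⟩ hS
      have hS' := mem_filter.1 hS
      have hSM := (mem_powersetCard.1 hS'.2).1
      obtain ⟨s, rfl⟩ := hmap S hSM
      obtain ⟨i, rfl⟩ := hsurj v (hSM (hH.2.1 _ hS'.1).2)
      exact ⟨(s, i), mem_filter.2 ⟨mem_univ _, hS'.1⟩, rfl⟩

lemma pdgWeight_le {V : Type*} [DecidableEq V] {k : ℕ} {θ : ℝ} (hθ : 0 ≤ θ) {H : PDG V}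
    (hH : H.IsValid k) (S : Finset V) : pdgWeight θ H S ≤ 1 + θ := by
  have h1 : #(H.dir.filter (fun q => q.1 = S)) ≤ 1 := by
    rw [card_le_one]
    intro a ha b hb
    rw [mem_filter] at ha hb
    exact hH.2.2.2 a ha.1 b hb.1 (ha.2.trans hb.2.symm)
  have h2 : (#(H.dir.filter (fun q => q.1 = S)) : ℝ) ≤ 1 := by exact_mod_cast h1
  unfold pdgWeight
  have := mul_le_mul_of_nonneg_left h2 hθ
  split_ifs <;> linarith

/-- Supersaturation: a PDG with few copies of `T_k` obeys the Turán bound. -/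
lemma weight_le_of_few_tkSets {k : ℕ} {θ p ε : ℝ} (hθ : 0 ≤ θ) (hp : TuranBound k θ p)
    (hε : 0 < ε) :
    ∃ δ : ℝ, 0 < δ ∧ ∃ m₀ : ℕ, ∀ (V : Type) [DecidableEq V] (H : PDG V) (M : Finset V),
      m₀ ≤ #M → H.IsValid k → (#(tkSets k H M) : ℝ) ≤ δ * (#M).choose (k + 1) →
      ∑ S ∈ M.powersetCard k, pdgWeight θ H S ≤ (p + ε) * (#M).choose k := by
  classical
  obtain ⟨N, hN⟩ := hp (ε / 2) (by linarith)
  set l := max N (k + 1) with hl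
  have hkl : k + 1 ≤ l := le_max_right _ _
  have hlk : (0 : ℝ) < l.choose k := by exact_mod_cast Nat.choose_pos (by omega)
  have hlk1 : (0 : ℝ) < l.choose (k + 1) := by exact_mod_cast Nat.choose_pos hkl
  refine ⟨ε / 2 / ((1 + θ) * l.choose (k + 1)), by positivity, l, fun V _ H M hM hH hfew => ?_⟩
  have hp0 := hp.nonneg
  have hpt : ∀ M₀ ∈ M.powersetCard l, ∑ S ∈ M₀.powersetCard k, pdgWeight θ H S ≤
      (p + ε / 2) * l.choose k + (1 + θ) * l.choose k *
        ∑ T ∈ M₀.powersetCard (k + 1), if T ∈ tkSets k H M then 1 else 0 := by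
    intro M₀ hM₀
    rw [mem_powersetCard] at hM₀
    by_cases hfree : ∀ φ, TkEmbeds k H φ → ¬ univ.image φ ⊆ M₀
    · have := sum_pdgWeight_le_of_tkFree (θ := θ) (b := (p + ε / 2) * l.choose k) hH (M := M₀)
        (by rw [hM₀.2]; exact hN l (le_max_left _ _)) hfree
      have h0 : (0 : ℝ) ≤ ∑ T ∈ M₀.powersetCard (k + 1), if T ∈ tkSets k H M then 1 else 0 :=
        sum_nonneg fun _ _ => by split_ifs <;> simp
      have : 0 ≤ (1 + θ) * l.choose k *
        ∑ T ∈ M₀.powersetCard (k + 1), (if T ∈ tkSets k H M then 1 else 0 : ℝ) := by positivity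
      linarith
    · push Not at hfree
      obtain ⟨φ, hφ, hφM⟩ := hfree
      have hcard : #(univ.image φ) = k + 1 := by
        rw [card_image_of_injective _ hφ.1]; simp
      have hT : univ.image φ ∈ tkSets k H M :=
        mem_filter.2 ⟨mem_powersetCard.2 ⟨hφM.trans hM₀.1, hcard⟩, φ, hφ, rfl⟩
      have h1 : (1 : ℝ) ≤ ∑ T ∈ M₀.powersetCard (k + 1), if T ∈ tkSets k H M then 1 else 0 := by
        refine le_trans ?_ (single_le_sum (fun _ _ => ?_) (mem_powersetCard.2 ⟨hφM, hcard⟩))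
        · rw [if_pos hT]
        · split_ifs <;> simp
      have h2 : ∑ S ∈ M₀.powersetCard k, pdgWeight θ H S ≤ (1 + θ) * l.choose k := by
        calc _ ≤ ∑ S ∈ M₀.powersetCard k, (1 + θ) := sum_le_sum fun S _ => pdgWeight_le hθ hH S
          _ = _ := by rw [sum_const, card_powersetCard, hM₀.2, nsmul_eq_mul, mul_comm]
      have h3 : (1 + θ) * (l.choose k : ℝ) ≤ (1 + θ) * l.choose k *
          ∑ T ∈ M₀.powersetCard (k + 1), (if T ∈ tkSets k H M then 1 else 0 : ℝ) :=
        le_mul_of_one_le_right (by positivity) h1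
      have h4 : 0 ≤ (p + ε / 2) * (l.choose k : ℝ) := by positivity
      linarith
  have hsum := sum_le_sum hpt
  rw [sum_powersetCard_powersetCard (by omega), sum_add_distrib, sum_const,
    card_powersetCard, nsmul_eq_mul, ← mul_sum, sum_powersetCard_powersetCard hkl] at hsum
  have hts : ∑ T ∈ M.powersetCard (k + 1), (if T ∈ tkSets k H M then 1 else 0 : ℝ) =
      #(tkSets k H M) := by
    rw [sum_boole]
    congr 2
    ext T
    simp only [mem_filter, and_iff_right_iff_imp]
    exact fun h => (mem_filter.1 h).1
  rw [hts] at hsum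
  have hA : ((#M).choose l * l.choose k : ℝ) = (#M).choose k * (#M - k).choose (l - k) := by
    exact_mod_cast Nat.choose_mul (n := #M) (k := l) (s := k) (by omega)
  have hB : ((#M).choose l * l.choose (k + 1) : ℝ) =
      (#M).choose (k + 1) * (#M - (k + 1)).choose (l - (k + 1)) := by
    exact_mod_cast Nat.choose_mul (n := #M) (k := l) (s := k + 1) hkl
  have hpos : (0 : ℝ) < (#M - k).choose (l - k) := by
    exact_mod_cast Nat.choose_pos (by omega)
  refine le_of_mul_le_mul_left ?_ hpos
  have hfew' : ((#M - (k + 1)).choose (l - (k + 1)) : ℝ) * #(tkSets k H M) ≤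
      ε / 2 / (1 + θ) * (#M).choose l := by
    calc _ ≤ ((#M - (k + 1)).choose (l - (k + 1)) : ℝ) *
          (ε / 2 / ((1 + θ) * l.choose (k + 1)) * (#M).choose (k + 1)) := by gcongr
      _ = ε / 2 / ((1 + θ) * l.choose (k + 1)) *
          ((#M).choose (k + 1) * (#M - (k + 1)).choose (l - (k + 1))) := by ring
      _ = ε / 2 / ((1 + θ) * l.choose (k + 1)) * ((#M).choose l * l.choose (k + 1)) := by rw [hB]
      _ = _ := by field_simp
  calc _ ≤ _ := hsum
    _ ≤ (#M).choose l * ((p + ε / 2) * l.choose k) + (1 + θ) * l.choose k *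
        (ε / 2 / (1 + θ) * (#M).choose l) := by gcongr
    _ = (p + ε) * ((#M).choose l * l.choose k) := by field_simp; ring
    _ = _ := by rw [hA]; ring

end Turan

section Formulas

open Finset

variable {V ι : Type}

/-- `u` picks one of `x i`, `y i` in each coordinate. -/
def InBox (x y u : ι → V) : Prop := ∀ i, u i = x i ∨ u i = y i

lemma InBox.index_eq [DecidableEq ι] {x y : ι → V} (hinj : ∀ u, InBox x y u → Function.Injective u)
    {u u' : ι → V} (hu : InBox x y u) (hu' : InBox x y u') {i j : ι} (h : u i = u' j) : i = j := by
  by_contra hij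
  have hb : InBox x y (Function.update u j (u' j)) := by
    intro a
    by_cases ha : a = j
    · subst ha; simpa using hu' a
    · simpa [ha] using hu a
  apply hij
  apply hinj _ hb
  simp [hij, h]

variable [DecidableEq V]

/-- The clause with literals `(u i, s i)` for `i ∈ J`. -/
def mkClause (u : ι → V) (J : Finset ι) (s : ι → Bool) : SatClause V :=
  J.image (fun i => (u i, s i))

lemma satisfies_mkClause {u : ι → V} {J : Finset ι} {s : ι → Bool} {w : V → Bool}
    (h : ∀ i ∈ J, w (u i) = s i) : SatisfiesClause w (mkClause u J s) := by
  intro l hl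
  obtain ⟨i, hi, rfl⟩ := mem_image.1 hl
  exact h i hi

lemma IsKClause.polarity_unique {k : ℕ} {C : SatClause V} (hC : IsKClause k C) {v : V} {a b : Bool}
    (ha : (v, a) ∈ C) (hb : (v, b) ∈ C) : a = b := by
  have hinj : Set.InjOn Prod.fst (C : Set (V × Bool)) := by
    rw [← card_image_iff]
    exact hC.2.trans hC.1.symm
  exact congrArg Prod.snd (hinj ha hb rfl)

lemma mem_clauseVars {C : SatClause V} {v : V} :
    v ∈ clauseVars C ↔ (v, true) ∈ C ∨ (v, false) ∈ C := by
  simp only [clauseVars, mem_image, Prod.exists, exists_and_right, exists_eq_right]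
  constructor
  · rintro ⟨b, hb⟩
    cases b
    · exact Or.inr hb
    · exact Or.inl hb
  · rintro (h | h)
    · exact ⟨_, h⟩
    · exact ⟨_, h⟩

lemma IsKClause.mem_iff {k : ℕ} {C : SatClause V} (hC : IsKClause k C) {v : V} {b : Bool} :
    (v, b) ∈ C ↔ v ∈ clauseVars C ∧ b = decide ((v, true) ∈ C) := by
  rw [mem_clauseVars]
  constructor
  · intro h
    cases b
    · refine ⟨Or.inr h, ?_⟩
      have : (v, true) ∉ C := fun h' => by simpa using hC.polarity_unique h h'
      simp [this]
    · exact ⟨Or.inl h, by simp [h]⟩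
  · rintro ⟨h, hb⟩
    by_cases ht : (v, true) ∈ C
    · simp only [ht, decide_true] at hb; rwa [hb]
    · simp only [ht, decide_false] at hb
      rw [hb]; exact h.resolve_left ht

lemma IsKClause.eq_of_vars {k : ℕ} {C C' : SatClause V} (hC : IsKClause k C) (hC' : IsKClause k C')
    (hv : clauseVars C = clauseVars C') (h : ∀ v, (v, true) ∈ C ↔ (v, true) ∈ C') : C = C' := by
  ext ⟨v, b⟩
  rw [hC.mem_iff, hC'.mem_iff, hv, decide_eq_decide.2 (h v)]

lemma IsKClause.eq_mkClause {k : ℕ} {C : SatClause V} (hC : IsKClause k C) {u : ι → V}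
    {J : Finset ι} (hv : clauseVars C = J.image u) :
    C = mkClause u J (fun i => decide ((u i, true) ∈ C)) := by
  ext ⟨v, b⟩
  rw [hC.mem_iff, hv]
  simp only [mkClause, mem_image, Prod.mk.injEq]
  constructor
  · rintro ⟨⟨i, hi, rfl⟩, rfl⟩
    exact ⟨i, hi, rfl, rfl⟩
  · rintro ⟨i, hi, rfl, rfl⟩
    exact ⟨⟨i, hi, rfl⟩, rfl⟩

lemma InBox.image_eq [DecidableEq ι] {x y : ι → V}
    (hinj : ∀ u, InBox x y u → Function.Injective u)
    {u u' : ι → V} (hu : InBox x y u) (hu' : InBox x y u') {J J' : Finset ι}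
    (h : J.image u = J'.image u') : J = J' ∧ ∀ i ∈ J, u i = u' i := by
  have key : ∀ i ∈ J, i ∈ J' ∧ u i = u' i := by
    intro i hi
    have : u i ∈ J'.image u' := h ▸ mem_image_of_mem u hi
    obtain ⟨j, hj, hji⟩ := mem_image.1 this
    have := hu'.index_eq hinj hu hji
    subst this
    exact ⟨hj, hji.symm⟩
  refine ⟨Subset.antisymm (fun i hi => (key i hi).1) fun j hj => ?_, fun i hi => (key i hi).2⟩
  have : u' j ∈ J.image u := h ▸ mem_image_of_mem u' hj
  obtain ⟨i, hi, hij⟩ := mem_image.1 this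
  have := hu.index_eq hinj hu' hij
  subst this
  exact hi

/-- In a minimal formula, the witness of a clause all of whose one-vertex replacements also occur
is forced on the replacing vertices. -/
lemma MinimalFormula.exists_box_witness [DecidableEq ι] {G : SatFormula V} (hG : MinimalFormula G)
    {x y : ι → V} (hxy : ∀ i, x i ≠ y i) (hinj : ∀ u, InBox x y u → Function.Injective u)
    {J : Finset ι} {s : ι → Bool} (hx : mkClause x J s ∈ G)
    (hswap : ∀ i ∈ J, mkClause (Function.update x i (y i)) J s ∈ G) :
    ∃ w : V → Bool, (∀ i ∈ J, w (x i) = s i ∧ w (y i) = !(s i)) ∧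
      ∀ C ∈ G, SatisfiesClause w C → C = mkClause x J s := by
  obtain ⟨w, hw, hun⟩ := hG _ hx
  refine ⟨w, fun i hi => ?_, hun⟩
  have hxi : ∀ j ∈ J, w (x j) = s j := fun j hj => hw (x j, s j) (mem_image_of_mem _ hj)
  refine ⟨hxi i hi, ?_⟩
  by_contra hne
  have hyi : w (y i) = s i := by
    cases h1 : w (y i) <;> cases h2 : s i <;> simp_all
  have hsat : SatisfiesClause w (mkClause (Function.update x i (y i)) J s) := by
    apply satisfies_mkClause
    intro j hj
    by_cases hji : j = i
    · subst hji; simpa using hyi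
    · simpa [hji] using hxi j hj
  have heq := hun _ (hswap i hi) hsat
  have hmem : (y i, s i) ∈ mkClause x J s := by
    rw [← heq]
    exact mem_image.2 ⟨i, hi, by simp⟩
  obtain ⟨j, _, hj⟩ := mem_image.1 hmem
  have hj' : x j = y i := congrArg Prod.fst hj
  have : j = i := InBox.index_eq hinj (u := x) (u' := y) (fun _ => Or.inl rfl) (fun _ => Or.inr rfl) hj'
  subst this
  exact hxy j hj'

/-- Lists of formulas on the `k`-subsets of `M`, such that every selection from the lists is
contained in a minimal formula. -/
structure RealizableLists (k : ℕ) (M : Finset V) (L : Finset V → Finset (SatFormula V)) : Prop where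
  isKClause : ∀ S ∈ M.powersetCard k, ∀ g ∈ L S, ∀ C ∈ g, IsKClause k C ∧ clauseVars C = S
  nonempty : ∀ S ∈ M.powersetCard k, (L S).Nonempty
  exists_minimal : ∀ c : Finset V → SatFormula V, (∀ S ∈ M.powersetCard k, c S ∈ L S) →
    ∃ G, MinimalFormula G ∧ ∀ S ∈ M.powersetCard k, c S ⊆ G

lemma RealizableLists.exists_minimal_of_partial {k : ℕ} {M : Finset V}
    {L : Finset V → Finset (SatFormula V)} (hL : RealizableLists k M L) {J : Type}
    (S : J → Finset V) (g : J → SatFormula V) (hS : ∀ j, S j ∈ M.powersetCard k)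
    (hg : ∀ j, g j ∈ L (S j)) (hcons : ∀ j j', S j = S j' → g j = g j') :
    ∃ G, MinimalFormula G ∧ ∀ j, g j ⊆ G := by
  have : ∀ S₀, ∃ c, (S₀ ∈ M.powersetCard k → c ∈ L S₀) ∧ ∀ j, S j = S₀ → c = g j := by
    intro S₀
    by_cases h : ∃ j, S j = S₀
    · obtain ⟨j, rfl⟩ := h
      exact ⟨g j, fun _ => hg j, fun j' hj' => hcons _ _ hj'.symm⟩
    · by_cases h' : S₀ ∈ M.powersetCard k
      · obtain ⟨c, hc⟩ := hL.nonempty _ h'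
        exact ⟨c, fun _ => hc, fun j hj => (h ⟨j, hj⟩).elim⟩
      · exact ⟨∅, fun h'' => (h' h'').elim, fun j hj => (h ⟨j, hj⟩).elim⟩
  choose c hc1 hc2 using this
  obtain ⟨G, hG, hsub⟩ := hL.exists_minimal c hc1
  exact ⟨G, hG, fun j => by rw [← hc2 (S j) j rfl]; exact hsub _ (hS j)⟩

/-- The list on `S` allows two clauses at once, or two clauses that differ on at least two
variables. -/
def BadList (L : Finset V → Finset (SatFormula V)) (S : Finset V) : Prop :=
  ∃ g₁ ∈ L S, ∃ g₂ ∈ L S, ∃ C₁ ∈ g₁, ∃ C₂ ∈ g₂, C₁ ≠ C₂ ∧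
    (g₁ = g₂ ∨ ∃ v v', v ≠ v' ∧ ¬((v, true) ∈ C₁ ↔ (v, true) ∈ C₂) ∧
      ¬((v', true) ∈ C₁ ↔ (v', true) ∈ C₂))

/-- `φ` enumerates a bad `k`-set whose two clauses have polarity patterns `s` and `t`. -/
def BadPattern {k : ℕ} (L : Finset V → Finset (SatFormula V)) (s t : Fin k → Bool)
    (φ : Fin k → V) : Prop :=
  Function.Injective φ ∧ ∃ g₁ ∈ L (univ.image φ), ∃ g₂ ∈ L (univ.image φ),
    mkClause φ univ s ∈ g₁ ∧ mkClause φ univ t ∈ g₂ ∧ s ≠ t ∧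
    (g₁ = g₂ ∨ ∃ i j, i ≠ j ∧ s i ≠ t i ∧ s j ≠ t j)

lemma BadList.exists_pattern {k : ℕ} {M : Finset V} {L : Finset V → Finset (SatFormula V)}
    (hL : RealizableLists k M L) {S : Finset V} (hS : S ∈ M.powersetCard k) (hbad : BadList L S) :
    ∃ s t : Fin k → Bool, ∃ φ : Fin k → V, (∀ i, φ i ∈ M) ∧ BadPattern L s t φ ∧
      univ.image φ = S := by
  obtain ⟨g₁, hg₁, g₂, hg₂, C₁, hC₁, C₂, hC₂, hne, h⟩ := hbad
  have hS' := mem_powersetCard.1 hS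
  let e := (S.equivFinOfCardEq hS'.2).symm
  let φ : Fin k → V := fun i => (e i : V)
  have hφ : univ.image φ = S := by
    ext v
    simp only [mem_image, mem_univ, true_and, φ]
    constructor
    · rintro ⟨i, rfl⟩; exact (e i).2
    · intro hv
      exact ⟨e.symm ⟨v, hv⟩, by simp⟩
  have hinj : Function.Injective φ := Subtype.val_injective.comp e.injective
  have h1 := hL.isKClause S hS g₁ hg₁ C₁ hC₁
  have h2 := hL.isKClause S hS g₂ hg₂ C₂ hC₂
  have e1 := h1.1.eq_mkClause (u := φ) (J := univ) (h1.2.trans hφ.symm)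
  have e2 := h2.1.eq_mkClause (u := φ) (J := univ) (h2.2.trans hφ.symm)
  refine ⟨_, _, φ, fun i => hS'.1 (e i).2, ⟨hinj, g₁, by rwa [hφ], g₂, by rwa [hφ], by rwa [← e1],
    by rwa [← e2], ?_, ?_⟩, hφ⟩
  · intro heq
    apply hne
    rw [e1, e2, heq]
  · rcases h with h | ⟨v, v', hvv', hv, hv'⟩
    · exact Or.inl h
    · right
      have hin : ∀ v, ¬((v, true) ∈ C₁ ↔ (v, true) ∈ C₂) → ∃ i, φ i = v := by
        intro v hv
        have : v ∈ S := by
          by_contra hvS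
          apply hv
          constructor
          · intro h; exact (hvS (h1.2 ▸ mem_clauseVars.2 (Or.inl h))).elim
          · intro h; exact (hvS (h2.2 ▸ mem_clauseVars.2 (Or.inl h))).elim
        rw [← hφ] at this
        simpa using this
      obtain ⟨i, rfl⟩ := hin v hv
      obtain ⟨j, rfl⟩ := hin v' hv'
      refine ⟨i, j, fun h => hvv' (congrArg φ h), ?_, ?_⟩
      · simpa [decide_eq_decide] using hv
      · simpa [decide_eq_decide] using hv'

lemma not_box_badPattern {k : ℕ} {M : Finset V} {L : Finset V → Finset (SatFormula V)}
    (hL : RealizableLists k M L) {s t : Fin k → Bool} {x y : Fin k → V} (hxy : ∀ i, x i ≠ y i)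
    (hM : ∀ u, InBox x y u → ∀ i, u i ∈ M) : ¬ ∀ u, InBox x y u → BadPattern L s t u := by
  classical
  intro hbox
  have hinj : ∀ u, InBox x y u → Function.Injective u := fun u hu => (hbox u hu).1
  choose! g₁ hg₁ g₂ hg₂ hC₁ hC₂ hst hor using fun u hu => (hbox u hu).2
  have hxb : InBox x y x := fun _ => Or.inl rfl
  set uD : Fin k → V := fun i => if t i = s i then x i else y i with huD
  have hDb : InBox x y uD := by
    intro i
    simp only [huD]
    split_ifs
    · exact Or.inl rfl
    · exact Or.inr rfl
  have hswb : ∀ i, InBox x y (Function.update x i (y i)) := by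
    intro i j
    by_cases hji : j = i
    · subst hji; simp
    · simp [hji]
  let two : Prop := ∃ i j, i ≠ j ∧ s i ≠ t i ∧ s j ≠ t j
  let sel : (Fin k → V) → SatFormula V := fun u => if u = uD ∧ two then g₂ u else g₁ u
  obtain ⟨G, hG, hsub⟩ := hL.exists_minimal_of_partial (J := {u // InBox x y u})
    (fun u => univ.image u.1) (fun u => sel u.1)
    (fun u => mem_powersetCard.2 ⟨by
      intro v hv
      obtain ⟨i, -, rfl⟩ := mem_image.1 hv
      exact hM u.1 u.2 i, by rw [card_image_of_injective _ (hinj u.1 u.2)]; simp⟩)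
    (fun u => by
      simp only [sel]
      split_ifs
      · exact hg₂ u.1 u.2
      · exact hg₁ u.1 u.2)
    (fun u u' h => by
      have := (u.2.image_eq hinj u'.2 h).2
      have : u.1 = u'.1 := funext fun i => this i (mem_univ i)
      rw [this])
  have hyx : ∀ i, t i ≠ s i → uD i = y i := fun i hi => by simp [huD, hi]
  have hfirst : ∀ u, InBox x y u → (two → u ≠ uD) → mkClause u univ s ∈ G := by
    intro u hu hne
    apply hsub ⟨u, hu⟩
    simp only [sel]
    rw [if_neg (fun h => hne h.2 h.1)]
    exact hC₁ u hu
  have hx : mkClause x univ s ∈ G := by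
    apply hfirst x hxb
    rintro ⟨i, -, -, hi, -⟩ h
    exact hxy i ((congrFun h i).trans (hyx i (Ne.symm hi)))
  have hsw : ∀ i ∈ univ, mkClause (Function.update x i (y i)) univ s ∈ G := by
    intro a _
    apply hfirst _ (hswb a)
    rintro ⟨i, j, hij, hi, hj⟩ h
    by_cases hia : i = a
    · have hja : j ≠ a := fun h => hij (hia.trans h.symm)
      have := congrFun h j
      rw [hyx j (Ne.symm hj)] at this
      simp only [ne_eq, hja, not_false_eq_true, Function.update_of_ne] at this
      exact hxy j this
    · have := congrFun h i
      rw [hyx i (Ne.symm hi)] at this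
      simp only [ne_eq, hia, not_false_eq_true, Function.update_of_ne] at this
      exact hxy i this
  have hD : mkClause uD univ t ∈ G := by
    apply hsub ⟨uD, hDb⟩
    simp only [sel, true_and]
    split_ifs with h2
    · exact hC₂ uD hDb
    · rw [(hor uD hDb).resolve_right h2]
      exact hC₂ uD hDb
  obtain ⟨w, hw, hun⟩ := hG.exists_box_witness hxy hinj hx hsw
  have hsat : SatisfiesClause w (mkClause uD univ t) := by
    apply satisfies_mkClause
    intro i hi
    simp only [huD]
    split_ifs with h
    · rw [(hw i hi).1, h]
    · rw [(hw i hi).2]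
      cases h1 : t i <;> cases h2 : s i <;> simp_all
  have heq := hun _ hD hsat
  obtain ⟨i, hi⟩ := Function.ne_iff.1 (hst uD hDb)
  have hmem : (uD i, t i) ∈ mkClause x univ s := by
    rw [← heq]; exact mem_image_of_mem _ (mem_univ i)
  obtain ⟨j, -, hj⟩ := mem_image.1 hmem
  have hj' : x j = uD i := congrArg Prod.fst hj
  have : j = i := hxb.index_eq hinj hDb hj'
  subst this
  rw [hyx j (Ne.symm hi)] at hj'
  exact hxy j hj'

/-- If no pattern occurs on a full box, then only few sets are enumerated by a pattern. -/
lemma card_le_of_forall_not_box (r : ℕ) (P : Type) [Fintype P] [Nonempty P] {δ : ℝ} (hδ : 0 < δ) :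
    ∃ N : ℕ, ∀ (V : Type) [DecidableEq V] (M : Finset V) (pat : P → (Fin r → V) → Prop)
      (A : Finset (Finset V)), N ≤ #M →
      (∀ p x y, (∀ i, x i ≠ y i) → (∀ u, InBox x y u → ∀ i, u i ∈ M) →
        ¬ ∀ u, InBox x y u → pat p u) →
      (∀ S ∈ A, ∃ p φ, (∀ i, φ i ∈ M) ∧ pat p φ ∧ univ.image φ = S) →
      (#A : ℝ) ≤ δ * (#M : ℝ) ^ r := by
  classical
  have hP : (0 : ℝ) < Fintype.card P := by exact_mod_cast Fintype.card_pos
  obtain ⟨N, hN⟩ := exists_box r (δ / Fintype.card P) (by positivity)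
  refine ⟨N, fun V _ M pat A hM hbox hA => ?_⟩
  let E : P → Finset (Fin r → V) := fun p => (Fintype.piFinset fun _ => M).filter (pat p)
  have hE : ∀ p : P, (#(E p) : ℝ) ≤ δ / Fintype.card P * (#M : ℝ) ^ r := by
    intro p
    by_contra h
    push Not at h
    obtain ⟨x, y, hxy, hb⟩ := hN V M (E p) hM
      (fun f hf i => Fintype.mem_piFinset.1 (mem_filter.1 hf).1 i) h.le
    exact hbox p x y hxy
      (fun u hu i => Fintype.mem_piFinset.1 (mem_filter.1 (hb u hu)).1 i)
      (fun u hu => (mem_filter.1 (hb u hu)).2)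
  have hsub : A ⊆ (univ : Finset P).biUnion fun p => (E p).image fun φ => univ.image φ := by
    intro S hS
    obtain ⟨p, φ, hφM, hφ, rfl⟩ := hA S hS
    exact mem_biUnion.2 ⟨p, mem_univ _, mem_image.2 ⟨φ, mem_filter.2
      ⟨Fintype.mem_piFinset.2 hφM, hφ⟩, rfl⟩⟩
  calc (#A : ℝ) ≤ ∑ p : P, (#(E p) : ℝ) := by
        exact_mod_cast (card_le_card hsub).trans (card_biUnion_le.trans
          (sum_le_sum fun _ _ => card_image_le))
    _ ≤ ∑ p : P, δ / Fintype.card P * (#M : ℝ) ^ r := sum_le_sum fun p _ => hE p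
    _ = _ := by
      rw [sum_const, card_univ, nsmul_eq_mul]
      field_simp

open Classical in
/-- Only few `k`-sets carry bad lists. -/
lemma card_badList_le (k : ℕ) {δ : ℝ} (hδ : 0 < δ) : ∃ N : ℕ, ∀ (V : Type) [DecidableEq V]
    (M : Finset V) (L : Finset V → Finset (SatFormula V)), N ≤ #M → RealizableLists k M L →
    (#((M.powersetCard k).filter (BadList L)) : ℝ) ≤ δ * (#M : ℝ) ^ k := by
  obtain ⟨N, hN⟩ := card_le_of_forall_not_box k ((Fin k → Bool) × (Fin k → Bool)) hδ
  refine ⟨N, fun V _ M L hM hL => hN V M (fun p => BadPattern L p.1 p.2) _ hM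
    (fun p x y hxy hu => not_box_badPattern hL hxy hu) fun S hS => ?_⟩
  obtain ⟨hS, hbad⟩ := mem_filter.1 hS
  obtain ⟨s, t, h⟩ := hbad.exists_pattern hL hS
  exact ⟨(s, t), h⟩

end Formulas

section FormulaType

open Finset

variable {V ι : Type}

open Classical in
/-- The PDG recording the shape of the lists that are not bad. -/
noncomputable def listPDG (k : ℕ) (M : Finset V) (L : Finset V → Finset (SatFormula V)) : PDG V where
  undir := (M.powersetCard k).filter (fun S => ¬ BadList L S ∧ #(L S) = 2)
  dir := ((M.powersetCard k) ×ˢ M).filter (fun q => ¬ BadList L q.1 ∧ #(L q.1) = 3 ∧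
    ∃ C₁ C₂, {C₁} ∈ L q.1 ∧ {C₂} ∈ L q.1 ∧ (q.2, true) ∈ C₁ ∧ (q.2, false) ∈ C₂)

lemma mem_listPDG_undir {k : ℕ} {M : Finset V} {L : Finset V → Finset (SatFormula V)}
    {S : Finset V} :
    S ∈ (listPDG k M L).undir ↔ S ∈ M.powersetCard k ∧ ¬ BadList L S ∧ #(L S) = 2 := by
  simp only [listPDG, mem_filter]

lemma mem_listPDG_dir {k : ℕ} {M : Finset V} {L : Finset V → Finset (SatFormula V)}
    {S : Finset V} {v : V} :
    (S, v) ∈ (listPDG k M L).dir ↔ (S ∈ M.powersetCard k ∧ v ∈ M) ∧ ¬ BadList L S ∧ #(L S) = 3 ∧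
      ∃ C₁ C₂, {C₁} ∈ L S ∧ {C₂} ∈ L S ∧ (v, true) ∈ C₁ ∧ (v, false) ∈ C₂ := by
  simp only [listPDG, mem_filter, mem_product]

variable [DecidableEq V]

/-- `φ` maps each `E a` onto a set whose list contains the single clause with polarities `s a`. -/
def TriplePattern (L : Finset V → Finset (SatFormula V)) (E : Fin 3 → Finset ι)
    (s : Fin 3 → ι → Bool) (φ : ι → V) : Prop :=
  Function.Injective φ ∧ ∀ a, {mkClause φ (E a) (s a)} ∈ L ((E a).image φ)

lemma not_box_triplePattern [Fintype ι] [DecidableEq ι] {k : ℕ} {M : Finset V}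
    {L : Finset V → Finset (SatFormula V)} (hL : RealizableLists k M L) {E : Fin 3 → Finset ι}
    (hE : Function.Injective E) (hEk : ∀ a, #(E a) = k) {z : ι} (h0 : E 0 = univ.erase z)
    (h1 : z ∈ E 1) (h2 : z ∈ E 2) {s : Fin 3 → ι → Bool} (hs : s 2 z ≠ s 1 z)
    {x y : ι → V} (hxy : ∀ i, x i ≠ y i) (hM : ∀ u, InBox x y u → ∀ i, u i ∈ M) :
    ¬ ∀ u, InBox x y u → TriplePattern L E s u := by
  intro hbox
  have hinj : ∀ u, InBox x y u → Function.Injective u := fun u hu => (hbox u hu).1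
  have hxb : InBox x y x := fun _ => Or.inl rfl
  obtain ⟨G, hG, hsub⟩ := hL.exists_minimal_of_partial (J := {u // InBox x y u} × Fin 3)
    (fun j => (E j.2).image j.1.1) (fun j => {mkClause j.1.1 (E j.2) (s j.2)})
    (fun j => mem_powersetCard.2 ⟨by
      intro v hv
      obtain ⟨i, -, rfl⟩ := mem_image.1 hv
      exact hM j.1.1 j.1.2 i,
      by rw [card_image_of_injective _ (hinj j.1.1 j.1.2), hEk]⟩)
    (fun j => (hbox j.1.1 j.1.2).2 j.2)
    (by
      rintro ⟨u, a⟩ ⟨u', a'⟩ h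
      obtain ⟨h1, h2⟩ := u.2.image_eq hinj u'.2 h
      have := hE h1
      subst this
      simp only [singleton_inj, mkClause]
      exact image_congr fun i hi => by simp only [h2 i hi])
  have hmem : ∀ u, InBox x y u → ∀ a, mkClause u (E a) (s a) ∈ G := fun u hu a =>
    hsub (⟨u, hu⟩, a) (mem_singleton_self _)
  obtain ⟨w, hw, hun⟩ := hG.exists_box_witness hxy hinj (hmem x hxb 0) (fun i _ => hmem _ (by
    intro j
    by_cases hji : j = i
    · subst hji; simp
    · simp [hji]) 0)
  obtain ⟨a, hza, ha⟩ : ∃ a, z ∈ E a ∧ s a z = w (x z) := by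
    by_cases h : s 1 z = w (x z)
    · exact ⟨1, h1, h⟩
    · refine ⟨2, h2, ?_⟩
      revert hs h
      cases s 1 z <;> cases s 2 z <;> cases w (x z) <;> simp
  set u : ι → V := fun i => if i = z then x i else if s a i = s 0 i then x i else y i with hu
  have hub : InBox x y u := by
    intro i
    simp only [hu]
    split_ifs
    · exact Or.inl rfl
    · exact Or.inl rfl
    · exact Or.inr rfl
  have hsat : SatisfiesClause w (mkClause u (E a) (s a)) := by
    apply satisfies_mkClause
    intro i _
    simp only [hu]
    split_ifs with hiz h
    · rw [hiz, ha]
    · rw [(hw i (by simp [h0, hiz])).1, h]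
    · rw [(hw i (by simp [h0, hiz])).2]
      revert h
      cases s a i <;> cases s 0 i <;> simp
  have heq := hun _ (hmem u hub a) hsat
  have hz : (u z, s a z) ∈ mkClause x (E 0) (s 0) := by
    rw [← heq]; exact mem_image_of_mem _ hza
  obtain ⟨j, hj, hjz⟩ := mem_image.1 hz
  have : j = z := hinj x hxb ((congrArg Prod.fst hjz).trans (by simp [hu]))
  subst this
  simp [h0] at hj

lemma exists_mem_not_iff {k : ℕ} {C C' : SatClause V} (hC : IsKClause k C) (hC' : IsKClause k C')
    (hv : clauseVars C = clauseVars C') (hne : C ≠ C') :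
    ∃ v ∈ clauseVars C, ¬((v, true) ∈ C ↔ (v, true) ∈ C') := by
  by_contra h
  push Not at h
  apply hne
  refine hC.eq_of_vars hC' hv fun v => ?_
  by_cases hvC : v ∈ clauseVars C
  · exact h v hvC
  · constructor
    · intro h'; exact (hvC (mem_clauseVars.2 (Or.inl h'))).elim
    · intro h'; exact (hvC (hv ▸ mem_clauseVars.2 (Or.inl h'))).elim

/-- Two clauses from a list that is not bad agree on all variables but one. -/
lemma iff_of_not_badList {L : Finset V → Finset (SatFormula V)} {S : Finset V}
    (hb : ¬ BadList L S) {C C' : SatClause V} (hC : {C} ∈ L S) (hC' : {C'} ∈ L S) {v v' : V}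
    (hvv' : v ≠ v') (hv : ¬((v, true) ∈ C ↔ (v, true) ∈ C')) :
    (v', true) ∈ C ↔ (v', true) ∈ C' := by
  by_contra hv'
  exact hb ⟨_, hC, _, hC', C, mem_singleton_self _, C', mem_singleton_self _,
    fun h => hv (by rw [h]), Or.inr ⟨v, v', hvv', hv, hv'⟩⟩

lemma eq_empty_or_singleton_of_not_badList {L : Finset V → Finset (SatFormula V)} {S : Finset V}
    (hb : ¬ BadList L S) {g : SatFormula V} (hg : g ∈ L S) : g = ∅ ∨ ∃ C, g = {C} := by
  rcases g.eq_empty_or_nonempty with h | ⟨C, hC⟩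
  · exact Or.inl h
  · refine Or.inr ⟨C, eq_singleton_iff_unique_mem.2 ⟨hC, fun C' hC' => ?_⟩⟩
    by_contra hne
    exact hb ⟨g, hg, g, hg, C', hC', C, hC, hne, Or.inl rfl⟩

/-- The clauses that form a list entry on their own. -/
def singleClauses (L : Finset V → Finset (SatFormula V)) (S : Finset V) : Finset (SatClause V) :=
  ((L S).biUnion id).filter (fun C => {C} ∈ L S)

lemma mem_singleClauses {L : Finset V → Finset (SatFormula V)} {S : Finset V} {C : SatClause V} :
    C ∈ singleClauses L S ↔ {C} ∈ L S := by
  simp only [singleClauses, mem_filter, mem_biUnion, id_eq, and_iff_right_iff_imp]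
  exact fun h => ⟨_, h, mem_singleton_self _⟩

lemma card_le_card_singleClauses {L : Finset V → Finset (SatFormula V)} {S : Finset V}
    (hb : ¬ BadList L S) : #(L S) ≤ #(singleClauses L S) + 1 := by
  have : L S ⊆ insert ∅ ((singleClauses L S).image singleton) := by
    intro g hg
    rcases eq_empty_or_singleton_of_not_badList hb hg with rfl | ⟨C, rfl⟩
    · exact mem_insert_self _ _
    · exact mem_insert_of_mem (mem_image_of_mem _ (mem_singleClauses.2 hg))
  exact (card_le_card this).trans ((card_insert_le _ _).trans
    (Nat.add_le_add_right card_image_le _))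

lemma card_singleClauses_le {k : ℕ} {M : Finset V} {L : Finset V → Finset (SatFormula V)}
    (hL : RealizableLists k M L) {S : Finset V} (hS : S ∈ M.powersetCard k)
    (hb : ¬ BadList L S) : #(singleClauses L S) ≤ 2 := by
  by_contra h
  push Not at h
  obtain ⟨C₁, h1, C₂, h2, C₃, h3, h12, h13, h23⟩ := two_lt_card.1 h
  rw [mem_singleClauses] at h1 h2 h3
  have k1 := hL.isKClause S hS _ h1 C₁ (mem_singleton_self _)
  have k2 := hL.isKClause S hS _ h2 C₂ (mem_singleton_self _)
  have k3 := hL.isKClause S hS _ h3 C₃ (mem_singleton_self _)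
  obtain ⟨v, -, hv⟩ := exists_mem_not_iff k1.1 k2.1 (k1.2.trans k2.2.symm) h12
  obtain ⟨v', -, hv'⟩ := exists_mem_not_iff k1.1 k3.1 (k1.2.trans k3.2.symm) h13
  obtain ⟨v'', -, hv''⟩ := exists_mem_not_iff k2.1 k3.1 (k2.2.trans k3.2.symm) h23
  by_cases hvv' : v = v'
  · subst hvv'
    by_cases hvv'' : v = v''
    · subst hvv''; tauto
    · have a := iff_of_not_badList hb h1 h2 hvv'' hv
      have b := iff_of_not_badList hb h1 h3 hvv'' hv'
      tauto
  · have a := iff_of_not_badList hb h1 h2 hvv' hv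
    have b := iff_of_not_badList hb h1 h3 (Ne.symm hvv') hv'
    have c := iff_of_not_badList hb h2 h3 (Ne.symm hvv') (by tauto)
    tauto

lemma RealizableLists.isValid_listPDG {k : ℕ} {M : Finset V} {L : Finset V → Finset (SatFormula V)}
    (hL : RealizableLists k M L) : (listPDG k M L).IsValid k := by
  refine ⟨?_, ?_, ?_, ?_⟩
  · intro S hS
    exact (mem_powersetCard.1 (mem_listPDG_undir.1 hS).1).2
  · rintro ⟨S, v⟩ hq
    obtain ⟨⟨hS, -⟩, -, -, C₁, -, h1, -, hv, -⟩ := mem_listPDG_dir.1 hq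
    refine ⟨(mem_powersetCard.1 hS).2, ?_⟩
    have := (hL.isKClause S hS _ h1 C₁ (mem_singleton_self _)).2
    exact this ▸ mem_clauseVars.2 (Or.inl hv)
  · rintro ⟨S, v⟩ hq hu
    have h2 := (mem_listPDG_dir.1 hq).2.2.1
    have h3 := (mem_listPDG_undir.1 hu).2.2
    simp [h3] at h2
  · rintro ⟨S, v⟩ hq ⟨S', v'⟩ hq' (rfl : S = S')
    obtain ⟨⟨hS, -⟩, hb, -, C₁, C₂, h1, h2, hv1, hv2⟩ := mem_listPDG_dir.1 hq
    obtain ⟨-, -, -, D₁, D₂, d1, d2, hd1, hd2⟩ := mem_listPDG_dir.1 hq'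
    by_contra hne
    have hvv' : v ≠ v' := fun h => hne (by rw [h])
    have hneg : ∀ C, {C} ∈ L S → ∀ v, (v, false) ∈ C → (v, true) ∉ C := by
      intro C hC v hvC hvC'
      have := (hL.isKClause S hS _ hC C (mem_singleton_self _)).1.polarity_unique hvC hvC'
      simp at this
    have n2 := hneg _ h2 _ hv2
    have n2' := hneg _ d2 _ hd2
    have a := iff_of_not_badList hb h1 h2 hvv' (fun h => n2 (h.1 hv1))
    have b := iff_of_not_badList hb d1 d2 (Ne.symm hvv') (fun h => n2' (h.1 hd1))
    have c11 := iff_of_not_badList hb h1 d1 hvv'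
    have c12 := iff_of_not_badList hb h1 d2 hvv'
    have c21 := iff_of_not_badList hb h2 d1 hvv'
    have c22 := iff_of_not_badList hb h2 d2 hvv'
    clear hneg hvv' hne hq hq' hb hL
    grind

lemma RealizableLists.log_card_le {k : ℕ} {M : Finset V} {L : Finset V → Finset (SatFormula V)}
    (hL : RealizableLists k M L) {S : Finset V} (hS : S ∈ M.powersetCard k)
    (hb : ¬ BadList L S) :
    Real.log #(L S) ≤ Real.log 2 * pdgWeight (Real.logb 2 3) (listPDG k M L) S := by
  have hcard := card_le_card_singleClauses hb
  have hcard2 := card_singleClauses_le hL hS hb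
  have hpos := (hL.nonempty S hS).card_pos
  have hlog2 : 0 < Real.log 2 := Real.log_pos (by norm_num)
  have hlog3 : 0 ≤ Real.logb 2 3 := Real.logb_nonneg (by norm_num) (by norm_num)
  have hmul : Real.log 2 * Real.logb 2 3 = Real.log 3 := by
    rw [Real.logb, mul_div_cancel₀ _ hlog2.ne']
  unfold pdgWeight
  obtain h | h | h : #(L S) = 1 ∨ #(L S) = 2 ∨ #(L S) = 3 := by omega
  · rw [h]
    simp only [Nat.cast_one, Real.log_one]
    positivity
  · rw [if_pos (mem_listPDG_undir.2 ⟨hS, hb, h⟩), h]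
    have : 0 ≤ Real.log 2 * (Real.logb 2 3 *
        #((listPDG k M L).dir.filter (fun q => q.1 = S))) := by positivity
    push_cast
    linarith
  · obtain ⟨C₁, C₂, h1, h2, hne⟩ := one_lt_card_iff.1 (show 1 < #(singleClauses L S) by omega)
    rw [mem_singleClauses] at h1 h2
    have k1 := hL.isKClause S hS _ h1 C₁ (mem_singleton_self _)
    have k2 := hL.isKClause S hS _ h2 C₂ (mem_singleton_self _)
    obtain ⟨v, hvS, hv⟩ := exists_mem_not_iff k1.1 k2.1 (k1.2.trans k2.2.symm) hne
    have hv1 := mem_clauseVars.1 hvS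
    have hv2 : v ∈ clauseVars C₂ := by rw [k2.2, ← k1.2]; exact hvS
    rw [mem_clauseVars] at hv2
    have hvM : v ∈ M := (mem_powersetCard.1 hS).1 (k1.2 ▸ hvS)
    have hmem : (S, v) ∈ (listPDG k M L).dir := by
      refine mem_listPDG_dir.2 ⟨⟨hS, hvM⟩, hb, h, ?_⟩
      by_cases hv' : (v, true) ∈ C₁
      · exact ⟨C₁, C₂, h1, h2, hv', by tauto⟩
      · exact ⟨C₂, C₁, h2, h1, by tauto, by tauto⟩
    have hc : (1 : ℝ) ≤ #((listPDG k M L).dir.filter (fun q => q.1 = S)) := by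
      exact Nat.one_le_cast.2 (card_pos.2 ⟨(S, v), mem_filter.2 ⟨hmem, rfl⟩⟩)
    have hi : (0 : ℝ) ≤ if S ∈ (listPDG k M L).undir then 1 else 0 := by
      split_ifs <;> norm_num
    rw [h, mul_add, ← mul_assoc, hmul]
    have h3 : 0 ≤ Real.log 3 := Real.log_nonneg (by norm_num)
    push_cast
    nlinarith [mul_nonneg hlog2.le hi, mul_le_mul_of_nonneg_left hc h3]

/-- There are at most `2 ^ 2 ^ k` sets of `k`-clauses on a given `k`-set of variables. -/
lemma card_le_of_forall_isKClause {k : ℕ} {S : Finset V} (hS : #S = k)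
    {A : Finset (SatFormula V)} (hA : ∀ g ∈ A, ∀ C ∈ g, IsKClause k C ∧ clauseVars C = S) :
    #A ≤ 2 ^ 2 ^ k := by
  set B : Finset (SatClause V) := A.biUnion id with hB
  have hBk : ∀ C ∈ B, IsKClause k C ∧ clauseVars C = S := by
    intro C hC
    obtain ⟨g, hg, hCg⟩ := mem_biUnion.1 hC
    exact hA g hg C hCg
  have hBcard : #B ≤ 2 ^ k := by
    rw [← hS, ← card_powerset]
    refine card_le_card_of_injOn (fun C => S.filter (fun v => (v, true) ∈ C))
      (fun C _ => mem_powerset.2 (filter_subset _ _)) ?_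
    intro C hC D hD h
    have hC := hBk C hC
    have hD := hBk D hD
    by_contra hne
    obtain ⟨v, hv, hv'⟩ := exists_mem_not_iff hC.1 hD.1 (hC.2.trans hD.2.symm) hne
    have := Finset.ext_iff.1 h v
    simp only [mem_filter, hC.2 ▸ hv, true_and] at this
    exact hv' this
  have : A ⊆ B.powerset := fun g hg => mem_powerset.2 fun C hC => mem_biUnion.2 ⟨g, hg, hC⟩
  calc #A ≤ 2 ^ #B := by rw [← card_powerset]; exact card_le_card this
    _ ≤ _ := Nat.pow_le_pow_right (by norm_num) hBcard

lemma RealizableLists.log_card_le_two_pow {k : ℕ} {M : Finset V}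
    {L : Finset V → Finset (SatFormula V)} (hL : RealizableLists k M L) {S : Finset V}
    (hS : S ∈ M.powersetCard k) : Real.log #(L S) ≤ 2 ^ k * Real.log 2 := by
  have hcl := card_le_of_forall_isKClause (mem_powersetCard.1 hS).2 (hL.isKClause S hS)
  have hpos := (hL.nonempty S hS).card_pos
  calc Real.log #(L S) ≤ Real.log ((2 : ℝ) ^ (2 ^ k)) :=
        Real.log_le_log (by exact_mod_cast hpos) (by exact_mod_cast hcl)
    _ = _ := by rw [Real.log_pow]; norm_num

end FormulaType

section FiniteBound

open Finset

/-- Only few `(k+1)`-sets span a copy of `T_k` in the PDG of realizable lists. -/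
lemma card_tkSets_listPDG_le {k : ℕ} (hk : 2 ≤ k) {δ : ℝ} (hδ : 0 < δ) :
    ∃ N : ℕ, ∀ (V : Type) [DecidableEq V] (M : Finset V) (L : Finset V → Finset (SatFormula V)),
      N ≤ #M → RealizableLists k M L →
      (#(tkSets k (listPDG k M L) M) : ℝ) ≤ δ * (#M : ℝ) ^ (k + 1) := by
  classical
  let z : Fin (k + 1) := ⟨k, Nat.lt_succ_self k⟩
  let r : Fin 3 → Fin (k + 1) := ![z, ⟨k - 2, by omega⟩, ⟨k - 1, by omega⟩]
  let E : Fin 3 → Finset (Fin (k + 1)) := fun a => univ.erase (r a)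
  have hr : Function.Injective r := by
    intro a b hab
    fin_cases a <;> fin_cases b <;> simp [r, z, Fin.ext_iff] at hab ⊢ <;> omega
  have hE : Function.Injective E := by
    intro a b hab
    apply hr
    by_contra hne
    have : r a ∈ E a := by rw [hab]; simp [E, hne]
    simp [E] at this
  have hEk : ∀ a, #(E a) = k := fun a => by simp [E]
  have h1 : z ∈ E 1 := by simp [E, r, z, Fin.ext_iff]; omega
  have h2 : z ∈ E 2 := by simp [E, r, z, Fin.ext_iff]; omega
  have : Nonempty {s : Fin 3 → Fin (k + 1) → Bool // s 2 z ≠ s 1 z} :=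
    ⟨⟨fun a _ => decide (a = 2), by simp⟩⟩
  obtain ⟨N, hN⟩ := card_le_of_forall_not_box (k + 1)
    {s : Fin 3 → Fin (k + 1) → Bool // s 2 z ≠ s 1 z} hδ
  refine ⟨N, fun V _ M L hM hL => hN V M (fun s => TriplePattern L E s.1) _ hM
    (fun s x y hxy hu => not_box_triplePattern hL hE hEk rfl h1 h2 s.2 hxy hu) fun T hT => ?_⟩
  obtain ⟨hTM, φ, ⟨hφ, hund, hdir⟩, hφT⟩ := mem_filter.1 hT
  have hφM : ∀ i, φ i ∈ M := fun i =>
    (mem_powersetCard.1 hTM).1 (hφT ▸ mem_image_of_mem φ (mem_univ i))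
  have hsingle : ∀ S, ¬ BadList L S → 1 < #(L S) → ∃ C, {C} ∈ L S := by
    intro S hb hcard
    have := card_le_card_singleClauses hb
    obtain ⟨C, hC⟩ := card_pos.1 (show 0 < #(singleClauses L S) by omega)
    exact ⟨C, mem_singleClauses.1 hC⟩
  have hundC : ∀ e ∈ (TkPDG k).undir, ∃ C, {C} ∈ L (e.image φ) := by
    intro e he
    rcases hund e he with h | ⟨v, h⟩
    · have := mem_listPDG_undir.1 h
      exact hsingle _ this.2.1 (by omega)
    · have := mem_listPDG_dir.1 h
      exact hsingle _ this.2.1 (by omega)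
  obtain ⟨C₀, hC₀⟩ := hundC (E 0) (by simp [TkPDG, E, r, z])
  obtain ⟨C₁, hC₁⟩ := hundC (E 1) (by simp [TkPDG, E, r])
  have hd : ((E 2).image φ, φ z) ∈ (listPDG k M L).dir :=
    hdir (E 2, z) (by simp [TkPDG, E, r, z])
  have hmem : ∀ a, (E a).image φ ∈ M.powersetCard k := by
    intro a
    refine mem_powersetCard.2 ⟨fun v hv => ?_, by rw [card_image_of_injective _ hφ, hEk]⟩
    obtain ⟨i, -, rfl⟩ := mem_image.1 hv
    exact hφM i
  obtain ⟨-, -, -, D, D', hD, hD', hzD, hzD'⟩ := mem_listPDG_dir.1 hd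
  have hzD'' : (φ z, true) ∉ D' := by
    intro h
    have := (hL.isKClause _ (hmem 2) _ hD' D' (mem_singleton_self _)).1.polarity_unique hzD' h
    simp at this
  obtain ⟨C₂, hC₂, hdiff⟩ : ∃ C₂, {C₂} ∈ L ((E 2).image φ) ∧
      ¬((φ z, true) ∈ C₂ ↔ (φ z, true) ∈ C₁) := by
    by_cases h : (φ z, true) ∈ C₁
    · exact ⟨D', hD', by tauto⟩
    · exact ⟨D, hD, by tauto⟩
  let C : Fin 3 → SatClause V := ![C₀, C₁, C₂]
  have hC : ∀ a, {C a} ∈ L ((E a).image φ) := by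
    intro a
    fin_cases a
    · exact hC₀
    · exact hC₁
    · exact hC₂
  refine ⟨⟨fun a i => decide ((φ i, true) ∈ C a), ?_⟩, φ, hφM, ⟨hφ, fun a => ?_⟩, hφT⟩
  · exact fun h => hdiff (decide_eq_decide.1 h)
  · have hka := hL.isKClause _ (hmem a) _ (hC a) (C a) (mem_singleton_self _)
    have := hka.1.eq_mkClause hka.2
    change {mkClause φ (E a) (fun i => decide ((φ i, true) ∈ C a))} ∈ _
    rw [← this]
    exact hC a

/-- Realizable lists on a large fixed number of variables obey the Turán bound. -/
lemma exists_realizableLists_bound {k : ℕ} (hk : 2 ≤ k) {p ε : ℝ}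
    (hp : TuranBound k (Real.logb 2 3) p) (hε : 0 < ε) :
    ∃ m : ℕ, k ≤ m ∧ ∀ (V : Type) [DecidableEq V] (M : Finset V)
      (L : Finset V → Finset (SatFormula V)), #M = m → RealizableLists k M L →
      ∑ S ∈ M.powersetCard k, Real.log #(L S) ≤ Real.log 2 * (p + ε) * m.choose k := by
  classical
  have hlog2 : 0 < Real.log 2 := Real.log_pos (by norm_num)
  have hθ : 0 ≤ Real.logb 2 3 := Real.logb_nonneg (by norm_num) (by norm_num)
  obtain ⟨δ, hδ, m₀, hm₀⟩ := weight_le_of_few_tkSets hθ hp (half_pos hε)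
  set K₁ : ℝ := 2 ^ (k + 1) * (k + 1).factorial with hK₁
  set K : ℝ := 2 ^ k * k.factorial with hK
  have hK₁pos : 0 < K₁ := by positivity
  have hKpos : 0 < K := by positivity
  obtain ⟨N₁, hN₁⟩ := card_tkSets_listPDG_le hk (δ := δ / K₁) (by positivity)
  obtain ⟨N₂, hN₂⟩ := card_badList_le k (δ := ε / (2 * 2 ^ k * K)) (by positivity)
  set m := m₀ + N₁ + N₂ + 2 * (k + 1) with hm
  refine ⟨m, by omega, fun V _ M L hM hL => ?_⟩
  have hpow1 : (m : ℝ) ^ (k + 1) ≤ K₁ * m.choose (k + 1) := pow_le_mul_choose (by omega)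
  have hpow : (m : ℝ) ^ k ≤ K * m.choose k := pow_le_mul_choose (by omega)
  have hw := hm₀ V (listPDG k M L) M (by omega) hL.isValid_listPDG (by
    refine (hN₁ V M L (by omega) hL).trans ?_
    rw [hM, div_mul_eq_mul_div, div_le_iff₀ hK₁pos]
    nlinarith)
  have hbad := hN₂ V M L (by omega) hL
  rw [hM] at hw hbad
  have hpdg : ∀ S, 0 ≤ pdgWeight (Real.logb 2 3) (listPDG k M L) S := by
    intro S
    unfold pdgWeight
    split_ifs <;> positivity
  calc ∑ S ∈ M.powersetCard k, Real.log #(L S)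
      ≤ ∑ S ∈ M.powersetCard k, (Real.log 2 * pdgWeight (Real.logb 2 3) (listPDG k M L) S +
          if BadList L S then 2 ^ k * Real.log 2 else 0) := by
        refine sum_le_sum fun S hS => ?_
        split_ifs with hb
        · have := hL.log_card_le_two_pow hS
          have := mul_nonneg hlog2.le (hpdg S)
          linarith
        · rw [add_zero]
          exact hL.log_card_le hS hb
    _ = Real.log 2 * ∑ S ∈ M.powersetCard k, pdgWeight (Real.logb 2 3) (listPDG k M L) S +
          #((M.powersetCard k).filter (BadList L)) * (2 ^ k * Real.log 2) := by
        rw [sum_add_distrib, ← mul_sum, ← sum_filter, sum_const, nsmul_eq_mul]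
    _ ≤ Real.log 2 * ((p + ε / 2) * m.choose k) +
          (ε / (2 * 2 ^ k * K) * (K * m.choose k)) * (2 ^ k * Real.log 2) := by
        have : (#((M.powersetCard k).filter (BadList L)) : ℝ) ≤
            ε / (2 * 2 ^ k * K) * (K * m.choose k) :=
          hbad.trans (mul_le_mul_of_nonneg_left hpow (by positivity))
        gcongr
    _ = _ := by
        field_simp
        ring

end FiniteBound

section CondAvg

open Finset

variable {Ω κ κ' : Type}

open Classical in
/-- The average of `f` over the members of `F` on which `π` takes the same value as at `ω`. -/
noncomputable def condAvg (F : Finset Ω) (π : Ω → κ) (f : Ω → ℝ) (ω : Ω) : ℝ :=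
  (∑ a ∈ F.filter (fun a => π a = π ω), f a) / #(F.filter (fun a => π a = π ω))

lemma condAvg_congr (F : Finset Ω) {π : Ω → κ} (f : Ω → ℝ) {ω ω' : Ω} (h : π ω = π ω') :
    condAvg F π f ω = condAvg F π f ω' := by
  unfold condAvg
  rw [h]

lemma condAvg_nonneg {F : Finset Ω} {π : Ω → κ} {f : Ω → ℝ} (hf : ∀ a, 0 ≤ f a) (ω : Ω) :
    0 ≤ condAvg F π f ω :=
  div_nonneg (sum_nonneg fun a _ => hf a) (Nat.cast_nonneg _)

lemma condAvg_le_one {F : Finset Ω} {π : Ω → κ} {f : Ω → ℝ} (hf : ∀ a, f a ≤ 1) (ω : Ω) :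
    condAvg F π f ω ≤ 1 := by
  refine div_le_one_of_le₀ ?_ (Nat.cast_nonneg _)
  calc _ ≤ ∑ a ∈ _, (1 : ℝ) := sum_le_sum fun a _ => hf a
    _ = _ := by simp

lemma sum_condAvg_mul {F : Finset Ω} {π : Ω → κ} {f g : Ω → ℝ}
    (hg : ∀ a ∈ F, ∀ b ∈ F, π a = π b → g a = g b) :
    ∑ ω ∈ F, condAvg F π f ω * g ω = ∑ ω ∈ F, f ω * g ω := by
  classical
  rw [← sum_fiberwise_of_maps_to (t := F.image π) (g := π) (fun a ha => mem_image_of_mem π ha),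
    ← sum_fiberwise_of_maps_to (t := F.image π) (g := π) (fun a ha => mem_image_of_mem π ha)]
  refine sum_congr rfl fun b hb => ?_
  obtain ⟨ω, hω, rfl⟩ := mem_image.1 hb
  have hcard : (#(F.filter (fun a => π a = π ω)) : ℝ) ≠ 0 := by
    exact Nat.cast_ne_zero.2 (card_ne_zero_of_mem (mem_filter.2 ⟨hω, rfl⟩))
  have h1 : ∀ a ∈ F.filter (fun a => π a = π ω),
      condAvg F π f a * g a = condAvg F π f ω * g ω := by
    intro a ha
    obtain ⟨haF, ha⟩ := mem_filter.1 ha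
    rw [condAvg_congr F f ha, hg a haF ω hω ha]
  have h2 : ∀ a ∈ F.filter (fun a => π a = π ω), f a * g a = f a * g ω := by
    intro a ha
    obtain ⟨haF, ha⟩ := mem_filter.1 ha
    rw [hg a haF ω hω ha]
  rw [sum_congr rfl h1, sum_congr rfl h2, sum_const, nsmul_eq_mul, ← sum_mul, condAvg]
  convert_to _ * (_ / (#(F.filter (fun a => π a = π ω)) : ℝ) * _) = _
  field_simp

/-- Pythagoras for conditional averages. -/
lemma sum_sq_condAvg_sub {F : Finset Ω} {π : Ω → κ} {π' : Ω → κ'} (f : Ω → ℝ)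
    (hπ : ∀ a b, π' a = π' b → π a = π b) :
    ∑ ω ∈ F, (condAvg F π' f ω - condAvg F π f ω) ^ 2 =
      ∑ ω ∈ F, condAvg F π' f ω ^ 2 - ∑ ω ∈ F, condAvg F π f ω ^ 2 := by
  have h1 : ∑ ω ∈ F, condAvg F π' f ω * condAvg F π f ω = ∑ ω ∈ F, f ω * condAvg F π f ω :=
    sum_condAvg_mul fun a _ b _ h => condAvg_congr F f (hπ a b h)
  have h2 : ∑ ω ∈ F, condAvg F π f ω * condAvg F π f ω = ∑ ω ∈ F, f ω * condAvg F π f ω :=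
    sum_condAvg_mul fun a _ b _ h => condAvg_congr F f h
  have h3 : ∀ ω, (condAvg F π' f ω - condAvg F π f ω) ^ 2 = condAvg F π' f ω ^ 2 -
      2 * (condAvg F π' f ω * condAvg F π f ω) + condAvg F π f ω * condAvg F π f ω := by
    intro ω; ring
  have h4 : ∀ ω, condAvg F π f ω ^ 2 = condAvg F π f ω * condAvg F π f ω := fun ω => by ring
  simp only [h3, h4, sum_add_distrib, sum_sub_distrib, ← mul_sum]
  linarith

open Classical in
/-- Some fibre of `π` is large and has small average of `D`. -/
lemma exists_large_fiber {F : Finset Ω} (hF : F.Nonempty) {π : Ω → κ} {K : ℕ}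
    (hK : #(F.image π) ≤ K) {D : Ω → ℝ} {ε : ℝ} (hε : 0 < ε) (hD0 : ∀ ω, 0 ≤ D ω)
    (hD : ∑ ω ∈ F, D ω ≤ ε * #F) :
    ∃ ω₀ ∈ F, (#F : ℝ) ≤ 2 * K * #(F.filter (fun a => π a = π ω₀)) ∧
      ∑ ω ∈ F.filter (fun a => π a = π ω₀), D ω ≤
        2 * ε * #(F.filter (fun a => π a = π ω₀)) := by
  have hne : (F.image π).Nonempty := hF.image π
  have hKpos : (0 : ℝ) < K := by exact_mod_cast hne.card_pos.trans_le hK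
  have hFpos : (0 : ℝ) < #F := by exact_mod_cast hF.card_pos
  have hsum1 : ∑ b ∈ F.image π, (#(F.filter (fun a => π a = b)) : ℝ) = #F := by
    exact_mod_cast (card_eq_sum_card_fiberwise (fun a ha => mem_image_of_mem π ha)).symm
  have hsum2 : ∑ b ∈ F.image π, ∑ ω ∈ F.filter (fun a => π a = b), D ω = ∑ ω ∈ F, D ω :=
    sum_fiberwise_of_maps_to (fun a ha => mem_image_of_mem π ha) _
  obtain ⟨b, hb, hle⟩ := exists_le_of_sum_le (s := F.image π)
    (f := fun b => #F / (2 * K) + (∑ ω ∈ F.filter (fun a => π a = b), D ω) / (2 * ε))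
    (g := fun b => (#(F.filter (fun a => π a = b)) : ℝ)) hne (by
      rw [sum_add_distrib, sum_const, nsmul_eq_mul, ← sum_div, hsum1, hsum2]
      have h1 : (#(F.image π) : ℝ) * (#F / (2 * K)) ≤ #F / 2 := by
        have : (#(F.image π) : ℝ) ≤ K := by exact_mod_cast hK
        calc (#(F.image π) : ℝ) * (#F / (2 * K)) ≤ K * (#F / (2 * K)) := by gcongr
          _ = _ := by field_simp
      have h2 : (∑ ω ∈ F, D ω) / (2 * ε) ≤ #F / 2 := by
        rw [div_le_iff₀ (by positivity)]
        linarith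
      linarith)
  obtain ⟨ω₀, hω₀, rfl⟩ := mem_image.1 hb
  have hDP : 0 ≤ ∑ ω ∈ F.filter (fun a => π a = π ω₀), D ω := sum_nonneg fun ω _ => hD0 ω
  refine ⟨ω₀, hω₀, ?_, ?_⟩
  · have h1 : (#F : ℝ) / (2 * K) ≤ #(F.filter (fun a => π a = π ω₀)) := by
      have := div_nonneg hDP (by positivity : 0 ≤ 2 * ε)
      linarith
    rw [div_le_iff₀ (by positivity)] at h1
    linarith
  · have h1 : (∑ ω ∈ F.filter (fun a => π a = π ω₀), D ω) / (2 * ε) ≤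
        #(F.filter (fun a => π a = π ω₀)) := by
      have : (0 : ℝ) ≤ #F / (2 * K) := by positivity
      linarith
    rw [div_le_iff₀ (by positivity)] at h1
    linarith

/-- If each `f a` may be replaced by `f' a` in products, and `f' a` is close to `p a`, then the
average of the product of all `f a` is almost at least the product of all `p a`. -/
lemma prod_le_sum_prod_add {α : Type} [DecidableEq α] (P : Finset Ω) (s : Finset α)
    (f f' : α → Ω → ℝ) (p : α → ℝ) (hf0 : ∀ a ω, 0 ≤ f a ω) (hf1 : ∀ a ω, f a ω ≤ 1)
    (hp0 : ∀ a, 0 ≤ p a) (hp1 : ∀ a, p a ≤ 1)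
    (hff' : ∀ a t, a ∉ t → insert a t ⊆ s →
      ∑ ω ∈ P, f a ω * ∏ b ∈ t, f b ω = ∑ ω ∈ P, f' a ω * ∏ b ∈ t, f b ω) :
    #P * ∏ a ∈ s, p a ≤ ∑ ω ∈ P, ∏ a ∈ s, f a ω + ∑ a ∈ s, ∑ ω ∈ P, |f' a ω - p a| := by
  suffices H : ∀ t ⊆ s,
      #P * ∏ a ∈ t, p a ≤ ∑ ω ∈ P, ∏ a ∈ t, f a ω + ∑ a ∈ t, ∑ ω ∈ P, |f' a ω - p a| from
    H s Subset.rfl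
  intro t
  induction t using Finset.induction_on with
  | empty => simp
  | insert a t ha ih =>
    intro hs
    have ih := ih ((subset_insert a t).trans hs)
    rw [prod_insert ha, sum_insert ha]
    have h1 : ∑ ω ∈ P, ∏ b ∈ insert a t, f b ω = ∑ ω ∈ P, f' a ω * ∏ b ∈ t, f b ω := by
      rw [← hff' a t ha hs]
      exact sum_congr rfl fun ω _ => prod_insert ha
    have h2 : p a * ∑ ω ∈ P, ∏ b ∈ t, f b ω ≤
        ∑ ω ∈ P, f' a ω * ∏ b ∈ t, f b ω + ∑ ω ∈ P, |f' a ω - p a| := by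
      rw [mul_sum, ← sum_add_distrib]
      refine sum_le_sum fun ω _ => ?_
      have h0 : 0 ≤ ∏ b ∈ t, f b ω := prod_nonneg fun b _ => hf0 b ω
      have h1 : ∏ b ∈ t, f b ω ≤ 1 := prod_le_one (fun b _ => hf0 b ω) fun b _ => hf1 b ω
      have h3 : p a - f' a ω ≤ |f' a ω - p a| := by
        rw [abs_sub_comm]; exact le_abs_self _
      nlinarith [mul_le_mul_of_nonneg_right h3 h0,
        mul_le_mul_of_nonneg_left h1 (abs_nonneg (f' a ω - p a))]
    have h3 : 0 ≤ ∑ b ∈ t, ∑ ω ∈ P, |f' b ω - p b| :=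
      sum_nonneg fun b _ => sum_nonneg fun ω _ => abs_nonneg _
    rw [h1]
    nlinarith [mul_le_mul_of_nonneg_left ih (hp0 a), mul_le_mul_of_nonneg_right (hp1 a) h3]

open Classical in
/-- Counting a family through the typical values of its coordinates. -/
lemma log_card_le_sum_log_card {α Q : Type} {P : Finset Ω} (hP : P.Nonempty) (I : Finset α)
    (X : α → Ω → Q) (B L : α → Finset Q) {q : ℕ} {η lam : ℝ} (hη : 0 ≤ η) (hlam : 0 < lam)
    (hlam1 : lam ≤ 1) (hinj : ∀ ω ∈ P, ∀ ω' ∈ P, (∀ a ∈ I, X a ω = X a ω') → ω = ω')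
    (hXB : ∀ a ∈ I, ∀ ω ∈ P, X a ω ∈ B a) (hB : ∀ a ∈ I, #(B a) ≤ q) (hL : ∀ a ∈ I, (L a).Nonempty)
    (hLB : ∀ a ∈ I, L a ⊆ B a)
    (hsmall : ∀ a ∈ I, ∀ c ∈ B a, c ∉ L a → (#(P.filter (fun ω => X a ω = c)) : ℝ) ≤ η * #P) :
    Real.log #P ≤ ∑ a ∈ I, Real.log #(L a) + #I * (lam * q + q * η * -Real.log lam) := by
  have hPpos : (0 : ℝ) < #P := by exact_mod_cast hP.card_pos
  have hlog : 0 ≤ -Real.log lam := by linarith [Real.log_nonpos hlam.le hlam1]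
  let g : α → Q → ℝ := fun a c => if c ∈ L a then 1 else lam
  have hg0 : ∀ a c, 0 < g a c := by
    intro a c; simp only [g]; split_ifs <;> linarith
  let U : Ω → ℝ := fun ω => ∑ a ∈ I, Real.log (g a (X a ω))
  have hexpU : ∀ ω, Real.exp (U ω) = ∏ a ∈ I, g a (X a ω) := by
    intro ω
    rw [Real.exp_sum]
    exact prod_congr rfl fun a _ => Real.exp_log (hg0 _ _)
  set y : ℝ := -(#I * (q * η * -Real.log lam)) with hy
  have hU : y * #P ≤ ∑ ω ∈ P, U ω := by
    rw [sum_comm]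
    have : ∀ a ∈ I, -(q * η * -Real.log lam) * #P ≤ ∑ ω ∈ P, Real.log (g a (X a ω)) := by
      intro a ha
      have h1 : ∀ ω, Real.log (g a (X a ω)) = if X a ω ∉ L a then Real.log lam else 0 := by
        intro ω
        simp only [g]
        split_ifs <;> simp_all
      simp only [h1]
      rw [← sum_filter, sum_const, nsmul_eq_mul]
      have h2 : (#(P.filter (fun ω => X a ω ∉ L a)) : ℝ) ≤ q * (η * #P) := by
        have hsub : P.filter (fun ω => X a ω ∉ L a) ⊆
            (B a \ L a).biUnion fun c => P.filter (fun ω => X a ω = c) := by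
          intro ω hω
          obtain ⟨hω, hn⟩ := mem_filter.1 hω
          exact mem_biUnion.2 ⟨X a ω, mem_sdiff.2 ⟨hXB a ha ω hω, hn⟩, mem_filter.2 ⟨hω, rfl⟩⟩
        calc (#(P.filter (fun ω => X a ω ∉ L a)) : ℝ)
            ≤ ∑ c ∈ B a \ L a, (#(P.filter (fun ω => X a ω = c)) : ℝ) := by
              exact_mod_cast (card_le_card hsub).trans card_biUnion_le
          _ ≤ ∑ c ∈ B a \ L a, η * #P := sum_le_sum fun c hc =>
              hsmall a ha c (mem_sdiff.1 hc).1 (mem_sdiff.1 hc).2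
          _ ≤ q * (η * #P) := by
              rw [sum_const, nsmul_eq_mul]
              gcongr
              exact (card_le_card sdiff_subset).trans (hB a ha)
      nlinarith [mul_le_mul_of_nonneg_right h2 hlog]
    calc y * #P = ∑ a ∈ I, -(q * η * -Real.log lam) * #P := by
          rw [sum_const, nsmul_eq_mul, hy]; ring
      _ ≤ _ := sum_le_sum this
  have hlow : Real.exp y * #P ≤ ∑ ω ∈ P, Real.exp (U ω) := by
    have h1 : ∀ ω ∈ P, Real.exp y * (1 + U ω - y) ≤ Real.exp (U ω) := by
      intro ω _
      have h2 : Real.exp (U ω) = Real.exp y * Real.exp (U ω - y) := by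
        rw [← Real.exp_add]; congr 1; ring
      rw [h2]
      have := Real.add_one_le_exp (U ω - y)
      exact mul_le_mul_of_nonneg_left (by linarith) (Real.exp_pos y).le
    refine le_trans ?_ (sum_le_sum h1)
    rw [← mul_sum]
    refine mul_le_mul_of_nonneg_left ?_ (Real.exp_pos y).le
    simp only [sum_sub_distrib, sum_add_distrib, sum_const, nsmul_eq_mul, mul_one]
    linarith
  have hup : ∑ ω ∈ P, Real.exp (U ω) ≤ ∏ a ∈ I, ∑ c ∈ B a, g a c := by
    rw [prod_sum]
    have hinj' : Set.InjOn (fun ω => (fun a (_ : a ∈ I) => X a ω)) (P : Set Ω) := by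
      intro ω hω ω' hω' h
      exact hinj ω hω ω' hω' fun a ha => congrFun (congrFun h a) ha
    have : ∑ ω ∈ P, Real.exp (U ω) = ∑ h ∈ P.image (fun ω => (fun a (_ : a ∈ I) => X a ω)),
        ∏ x ∈ I.attach, g x.1 (h x.1 x.2) := by
      rw [sum_image hinj']
      refine sum_congr rfl fun ω _ => ?_
      rw [hexpU, ← prod_attach]
    rw [this]
    refine sum_le_sum_of_subset_of_nonneg ?_ fun h _ _ => prod_nonneg fun x _ => (hg0 _ _).le
    intro h hh
    obtain ⟨ω, hω, rfl⟩ := mem_image.1 hh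
    exact mem_pi.2 fun a ha => hXB a ha ω hω
  have hfac : ∀ a ∈ I, ∑ c ∈ B a, g a c ≤ #(L a) * Real.exp (lam * q) := by
    intro a ha
    have h1 : ∑ c ∈ B a, g a c ≤ #(L a) + lam * q := by
      rw [← sum_sdiff (hLB a ha)]
      have e1 : ∑ c ∈ L a, g a c = #(L a) := by
        rw [sum_congr rfl (fun c hc => show g a c = 1 by simp [g, hc])]; simp
      have e2 : ∑ c ∈ B a \ L a, g a c = #(B a \ L a) * lam := by
        rw [sum_congr rfl (fun c hc => show g a c = lam by simp [g, (mem_sdiff.1 hc).2])]; simp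
      rw [e1, e2]
      have : (#(B a \ L a) : ℝ) ≤ q := by
        exact_mod_cast (card_le_card sdiff_subset).trans (hB a ha)
      nlinarith
    have h2 : (1 : ℝ) ≤ #(L a) := by exact_mod_cast (hL a ha).card_pos
    have h3 := Real.add_one_le_exp (lam * q)
    have h4 : 0 ≤ lam * q := by positivity
    nlinarith
  have hmain : Real.exp y * #P ≤ ∏ a ∈ I, (#(L a) * Real.exp (lam * q)) :=
    hlow.trans (hup.trans (prod_le_prod (fun a _ => sum_nonneg fun c _ => (hg0 a c).le) hfac))
  have hlogs := Real.log_le_log (by positivity) hmain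
  rw [Real.log_mul (Real.exp_pos y).ne' hPpos.ne', Real.log_exp, Real.log_prod (fun a ha => by
    have : (0 : ℝ) < #(L a) := by exact_mod_cast (hL a ha).card_pos
    positivity)] at hlogs
  have : ∑ a ∈ I, Real.log (#(L a) * Real.exp (lam * q)) =
      ∑ a ∈ I, Real.log #(L a) + #I * (lam * q) := by
    rw [← nsmul_eq_mul, ← sum_const, ← sum_add_distrib]
    refine sum_congr rfl fun a ha => ?_
    have : (0 : ℝ) < #(L a) := by exact_mod_cast (hL a ha).card_pos
    rw [Real.log_mul this.ne' (Real.exp_pos _).ne', Real.log_exp]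
  rw [this] at hlogs
  rw [hy] at hlogs
  linarith

end CondAvg

section Energy

open Finset

variable {V Ω Q : Type}

/-- A partial assignment of values to sets. It is a definition rather than an abbreviation, so
that equality of partial assignments is decided classically. -/
def PartialValues (V Q : Type) : Type := Finset V → Option Q

open Classical in
/-- The values of `X` on the `k`-sets that meet `A`. -/
noncomputable def exposed (k : ℕ) (X : Finset V → Ω → Q) (A : Finset V) (ω : Ω) :
    PartialValues V Q :=
  fun S => if #S = k ∧ ¬ Disjoint S A then some (X S ω) else none

lemma exposed_eq_iff {k : ℕ} {X : Finset V → Ω → Q} {A : Finset V} {ω ω' : Ω} :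
    exposed k X A ω = exposed k X A ω' ↔ ∀ S, #S = k → ¬ Disjoint S A → X S ω = X S ω' := by
  constructor
  · intro h S hS hSA
    have := congrFun h S
    simpa [exposed, hS, hSA] using this
  · intro h
    funext S
    unfold exposed
    split_ifs with hS
    · rw [h S hS.1 hS.2]
    · rfl

lemma exposed_mono {k : ℕ} {X : Finset V → Ω → Q} {A A' : Finset V} (hA : A ⊆ A') {ω ω' : Ω}
    (h : exposed k X A' ω = exposed k X A' ω') : exposed k X A ω = exposed k X A ω' := by
  rw [exposed_eq_iff] at h ⊢
  exact fun S hS hSA => h S hS fun hd => hSA (hd.mono_right hA)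

open Classical in
/-- The indicator of `X S = c`. -/
noncomputable def valueInd (X : Finset V → Ω → Q) (S : Finset V) (c : Q) (ω : Ω) : ℝ :=
  if X S ω = c then 1 else 0

lemma valueInd_nonneg (X : Finset V → Ω → Q) (S : Finset V) (c : Q) (ω : Ω) :
    0 ≤ valueInd X S c ω := by
  unfold valueInd; split_ifs <;> norm_num

lemma valueInd_le_one (X : Finset V → Ω → Q) (S : Finset V) (c : Q) (ω : Ω) :
    valueInd X S c ω ≤ 1 := by
  unfold valueInd; split_ifs <;> norm_num

open Classical in
/-- The mean square of the conditional probabilities of the values of `X S`. -/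
noncomputable def energyAt (F : Finset Ω) (k : ℕ) (X : Finset V → Ω → Q) (A S : Finset V) : ℝ :=
  ∑ c ∈ F.image (X S), ∑ ω ∈ F, condAvg F (exposed k X A) (valueInd X S c) ω ^ 2

lemma energyAt_mono (F : Finset Ω) (k : ℕ) (X : Finset V → Ω → Q) {A A' : Finset V} (S : Finset V)
    (hA : A ⊆ A') : energyAt F k X A S ≤ energyAt F k X A' S := by
  refine sum_le_sum fun c _ => ?_
  have h1 := sum_sq_condAvg_sub (F := F) (valueInd X S c)
    (π := exposed k X A) (π' := exposed k X A') fun a b h => exposed_mono hA h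
  have h2 : 0 ≤ ∑ ω ∈ F, (condAvg F (exposed k X A') (valueInd X S c) ω -
    condAvg F (exposed k X A) (valueInd X S c) ω) ^ 2 := sum_nonneg fun ω _ => sq_nonneg _
  linarith

lemma energyAt_nonneg (F : Finset Ω) (k : ℕ) (X : Finset V → Ω → Q) (A S : Finset V) :
    0 ≤ energyAt F k X A S :=
  sum_nonneg fun _ _ => sum_nonneg fun _ _ => sq_nonneg _

open Classical in
lemma energyAt_le {F : Finset Ω} {k q : ℕ} {X : Finset V → Ω → Q} {S : Finset V}
    (hq : #(F.image (X S)) ≤ q) (A : Finset V) : energyAt F k X A S ≤ q * #F := by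
  calc energyAt F k X A S ≤ ∑ c ∈ F.image (X S), ∑ ω ∈ F, (1 : ℝ) := by
        refine sum_le_sum fun c _ => sum_le_sum fun ω _ => ?_
        exact pow_le_one₀ (condAvg_nonneg (valueInd_nonneg X S c) ω)
          (condAvg_le_one (valueInd_le_one X S c) ω)
    _ ≤ _ := by
        simp only [sum_const, nsmul_eq_mul, mul_one]
        gcongr

variable [DecidableEq V]

open Classical in
/-- How much exposing the rest of `M` changes the conditional distributions on the `k`-subsets
of `M`. -/
noncomputable def deviation (F : Finset Ω) (k : ℕ) (X : Finset V → Ω → Q) (A M : Finset V)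
    (ω : Ω) : ℝ :=
  ∑ S ∈ M.powersetCard k, ∑ c ∈ F.image (X S),
    (condAvg F (exposed k X (A ∪ M \ S)) (valueInd X S c) ω -
      condAvg F (exposed k X A) (valueInd X S c) ω) ^ 2

lemma deviation_nonneg (F : Finset Ω) (k : ℕ) (X : Finset V → Ω → Q) (A M : Finset V) (ω : Ω) :
    0 ≤ deviation F k X A M ω :=
  sum_nonneg fun _ _ => sum_nonneg fun _ _ => sq_nonneg _

lemma sum_deviation (F : Finset Ω) (k : ℕ) (X : Finset V → Ω → Q) (A M : Finset V) :
    ∑ ω ∈ F, deviation F k X A M ω =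
      ∑ S ∈ M.powersetCard k, (energyAt F k X (A ∪ M \ S) S - energyAt F k X A S) := by
  unfold deviation
  rw [sum_comm]
  refine sum_congr rfl fun S _ => ?_
  rw [sum_comm, energyAt, energyAt, ← sum_sub_distrib]
  exact sum_congr rfl fun c _ => sum_sq_condAvg_sub _ fun a b h => exposed_mono subset_union_left h

lemma exists_small_increment {Φ : Finset V → ℝ} {B : ℝ} (hΦ0 : ∀ A, 0 ≤ Φ A) (hΦB : ∀ A, Φ A ≤ B)
    {T : ℕ} (hT : 0 < T) (w : ℕ) :
    ∃ A, #A ≤ T * w ∧ ∀ A', #A' = w → Φ (A ∪ A') - Φ A ≤ B / T := by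
  by_contra h
  push Not at h
  have hstep : ∀ t ≤ T, ∃ A, #A ≤ t * w ∧ t * (B / T) ≤ Φ A := by
    intro t
    induction t with
    | zero => exact fun _ => ⟨∅, by simp, by simpa using hΦ0 ∅⟩
    | succ t ih =>
      intro ht
      obtain ⟨A, hA, hΦA⟩ := ih (by omega)
      obtain ⟨A', hA', hlt⟩ := h A (hA.trans (Nat.mul_le_mul_right w (by omega)))
      refine ⟨A ∪ A', (card_union_le _ _).trans ?_, ?_⟩
      · rw [hA', Nat.succ_mul]; omega
      · push_cast
        linarith
  obtain ⟨A, hA, hΦA⟩ := hstep T le_rfl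
  obtain ⟨A', -, hlt⟩ := h A hA
  have h1 := hΦB (A ∪ A')
  have hT' : (0 : ℝ) < T := by exact_mod_cast hT
  have h2 : 0 ≤ B / T := div_nonneg ((hΦ0 ∅).trans (hΦB ∅)) hT'.le
  rw [mul_div_cancel₀ _ hT'.ne'] at hΦA
  linarith

open Classical in
/-- After exposing few vertices, the total deviation is small. -/
lemma exists_small_deviation [Fintype V] (F : Finset Ω) {k m q T : ℕ} (X : Finset V → Ω → Q)
    (hT : 0 < T) (hq : ∀ S, #S = k → #(F.image (X S)) ≤ q) :
    ∃ A : Finset V, #A ≤ T * (m - k) ∧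
      ∑ ω ∈ F, ∑ M ∈ powersetCard m (univ : Finset V), deviation F k X A M ω ≤
        (Fintype.card V).choose (m - k) * ((Fintype.card V).choose k * (q * #F) / T) := by
  set I := powersetCard k (univ : Finset V) with hI
  obtain ⟨A, hA, hinc⟩ := exists_small_increment (Φ := fun A => ∑ S ∈ I, energyAt F k X A S)
    (B := (Fintype.card V).choose k * (q * #F))
    (fun A => sum_nonneg fun S _ => energyAt_nonneg F k X A S)
    (fun A => by
      calc ∑ S ∈ I, energyAt F k X A S ≤ ∑ S ∈ I, (q * #F : ℝ) :=
            sum_le_sum fun S hS => energyAt_le (hq S (mem_powersetCard.1 hS).2) A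
        _ = _ := by rw [sum_const, nsmul_eq_mul, hI, card_powersetCard, card_univ]) hT (m - k)
  refine ⟨A, hA, ?_⟩
  rw [sum_comm]
  simp only [sum_deviation]
  have hnn : ∀ B S, 0 ≤ energyAt F k X (A ∪ B) S - energyAt F k X A S := fun B S =>
    sub_nonneg.2 (energyAt_mono F k X S subset_union_left)
  calc ∑ M ∈ powersetCard m univ, ∑ S ∈ M.powersetCard k,
        (energyAt F k X (A ∪ M \ S) S - energyAt F k X A S)
      ≤ ∑ q ∈ powersetCard (m - k) (univ : Finset V) ×ˢ I,
          (energyAt F k X (A ∪ q.1) q.2 - energyAt F k X A q.2) := by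
        rw [sum_sigma']
        refine (sum_image (f := fun q : Finset V × Finset V =>
          energyAt F k X (A ∪ q.1) q.2 - energyAt F k X A q.2)
          (g := fun x : (_ : Finset V) × Finset V => (x.1 \ x.2, x.2)) ?_).symm.trans_le ?_
        · rintro ⟨M, S⟩ hx ⟨M', S'⟩ hx' h
          simp only [coe_sigma, Set.mem_sigma_iff, mem_coe, mem_powersetCard] at hx hx'
          simp only [Prod.mk.injEq] at h
          obtain ⟨h1, rfl⟩ := h
          have : M = M' := by
            rw [← sdiff_union_of_subset hx.2.1, h1, sdiff_union_of_subset hx'.2.1]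
          rw [this]
        · refine sum_le_sum_of_subset_of_nonneg ?_ fun q _ _ => hnn _ _
          intro q hq
          obtain ⟨⟨M, S⟩, hx, rfl⟩ := mem_image.1 hq
          simp only [mem_sigma, mem_powersetCard] at hx
          refine mem_product.2 ⟨mem_powersetCard.2 ⟨subset_univ _, ?_⟩,
            mem_powersetCard.2 ⟨subset_univ _, hx.2.2⟩⟩
          rw [card_sdiff_of_subset hx.2.1, hx.1.2, hx.2.2]
    _ = ∑ B ∈ powersetCard (m - k) (univ : Finset V),
          (∑ S ∈ I, energyAt F k X (A ∪ B) S - ∑ S ∈ I, energyAt F k X A S) := by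
        rw [sum_product]
        exact sum_congr rfl fun B _ => sum_sub_distrib _ _
    _ ≤ ∑ B ∈ powersetCard (m - k) (univ : Finset V),
          ((Fintype.card V).choose k * (q * #F) / T : ℝ) :=
        sum_le_sum fun B hB => hinc B (mem_powersetCard.1 hB).2
    _ = _ := by rw [sum_const, nsmul_eq_mul, card_powersetCard, card_univ]

open Classical in
/-- On a class of the exposed values where the deviation on `M` is small, any frequent values on
the `k`-subsets of `M` occur simultaneously. -/
lemma exists_simultaneous {F : Finset Ω} {k : ℕ} {X : Finset V → Ω → Q} {A M : Finset V} {η : ℝ}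
    (hη : 0 < η) {ω₀ : Ω} (hω₀ : ω₀ ∈ F)
    (hdev : ∑ ω ∈ F.filter (fun a => exposed k X A a = exposed k X A ω₀), deviation F k X A M ω *
      (2 * #(M.powersetCard k)) ≤
      η ^ (2 * #(M.powersetCard k)) * #(F.filter (fun a => exposed k X A a = exposed k X A ω₀)))
    {c : Finset V → Q} (hM : (M.powersetCard k).Nonempty)
    (hc : ∀ S ∈ M.powersetCard k,
      η * #(F.filter (fun a => exposed k X A a = exposed k X A ω₀)) ≤
        #((F.filter (fun a => exposed k X A a = exposed k X A ω₀)).filter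
          (fun ω => X S ω = c S))) :
    ∃ ω ∈ F, ∀ S ∈ M.powersetCard k, X S ω = c S := by
  set P := F.filter (fun a => exposed k X A a = exposed k X A ω₀) with hP
  set s := M.powersetCard k with hs
  set r := #s with hr
  have hPpos : (0 : ℝ) < #P := Nat.cast_pos.2 (card_pos.2 ⟨ω₀, mem_filter.2 ⟨hω₀, rfl⟩⟩)
  have hrpos : (0 : ℝ) < r := Nat.cast_pos.2 (card_pos.2 hM)
  let f : Finset V → Ω → ℝ := fun S => valueInd X S (c S)
  let f' : Finset V → Ω → ℝ := fun S => condAvg F (exposed k X (A ∪ M \ S)) (f S)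
  let p : Finset V → ℝ := fun S => condAvg F (exposed k X A) (f S) ω₀
  have hkey := prod_le_sum_prod_add P s f f' p (fun S => valueInd_nonneg X S _)
    (fun S => valueInd_le_one X S _) (fun S => condAvg_nonneg (valueInd_nonneg X S _) _)
    (fun S => condAvg_le_one (valueInd_le_one X S _) _) (by
      intro S t hSt hts
      have hS := mem_powersetCard.1 (hts (mem_insert_self S t))
      have hcond := sum_condAvg_mul (F := F) (π := exposed k X (A ∪ M \ S)) (f := f S)
        (g := fun ω => if exposed k X A ω = exposed k X A ω₀ then ∏ b ∈ t, f b ω else 0) (by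
          intro a _ b _ hab
          have h1 := exposed_mono (subset_union_left (s₂ := M \ S)) hab
          simp only [h1]
          have h2 : ∀ S' ∈ t, f S' a = f S' b := by
            intro S' hS'
            have hS'M := mem_powersetCard.1 (hts (mem_insert_of_mem hS'))
            have hXe : X S' a = X S' b := by
              refine exposed_eq_iff.1 hab S' hS'M.2 fun hd => ?_
              have hsub : S' ⊆ S := by
                intro v hv
                by_contra hvS
                exact disjoint_left.1 hd hv
                  (mem_union_right _ (mem_sdiff.2 ⟨hS'M.1 hv, hvS⟩))
              have : S' = S := eq_of_subset_of_card_le hsub (by rw [hS.2, hS'M.2])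
              exact hSt (this ▸ hS')
            simp only [f, valueInd, hXe]
          rw [prod_congr rfl h2])
      simp only [mul_ite, mul_zero, ← sum_filter] at hcond
      exact hcond.symm)
  have hp : ∀ S ∈ s, η ≤ p S := by
    intro S hS
    have h1 : p S = #(P.filter (fun ω => X S ω = c S)) / #P := by
      simp only [p, condAvg, f, valueInd]
      rw [sum_boole]
    rw [h1, le_div_iff₀ hPpos]
    exact hc S hS
  have hprod : η ^ r ≤ ∏ S ∈ s, p S := by
    rw [hr, ← prod_const]
    exact prod_le_prod (fun _ _ => hη.le) hp
  have hηr : 0 < η ^ r := pow_pos hη r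
  have habs : ∑ S ∈ s, ∑ ω ∈ P, |f' S ω - p S| ≤ #P * (η ^ r * (3 / 4)) := by
    set a := η ^ r / r with ha
    have hapos : 0 < a := by positivity
    have h1 : ∀ S ∈ s, ∀ ω ∈ P, |f' S ω - p S| ≤ (f' S ω - p S) ^ 2 / (2 * a) + a / 2 := by
      intro S _ ω _
      have h2 : 0 ≤ (|f' S ω - p S| - a) ^ 2 := sq_nonneg _
      rw [← sq_abs, ← sub_le_iff_le_add, le_div_iff₀ (by positivity)]
      nlinarith
    have h2 : ∑ S ∈ s, ∑ ω ∈ P, (f' S ω - p S) ^ 2 ≤ ∑ ω ∈ P, deviation F k X A M ω := by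
      rw [sum_comm]
      refine sum_le_sum fun ω hω => sum_le_sum fun S hS => ?_
      have hPω := (mem_filter.1 hω).2
      have hcS : c S ∈ F.image (X S) := by
        have h3 : (0 : ℝ) < #(P.filter (fun ω => X S ω = c S)) :=
          (mul_pos hη hPpos).trans_le (hc S hS)
        obtain ⟨ω', hω'⟩ := card_pos.1 (Nat.cast_pos.1 h3)
        obtain ⟨h4, h5⟩ := mem_filter.1 hω'
        exact mem_image.2 ⟨ω', (mem_filter.1 h4).1, h5⟩
      have h3 : p S = condAvg F (exposed k X A) (f S) ω := condAvg_congr F _ hPω.symm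
      rw [h3]
      exact single_le_sum (f := fun c => (condAvg F (exposed k X (A ∪ M \ S)) (valueInd X S c) ω -
        condAvg F (exposed k X A) (valueInd X S c) ω) ^ 2) (fun _ _ => sq_nonneg _) hcS
    rw [← sum_mul] at hdev
    calc ∑ S ∈ s, ∑ ω ∈ P, |f' S ω - p S|
        ≤ ∑ S ∈ s, ∑ ω ∈ P, ((f' S ω - p S) ^ 2 / (2 * a) + a / 2) :=
          sum_le_sum fun S hS => sum_le_sum fun ω hω => h1 S hS ω hω
      _ = (∑ S ∈ s, ∑ ω ∈ P, (f' S ω - p S) ^ 2) / (2 * a) + r * (#P * (a / 2)) := by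
          simp only [sum_add_distrib, sum_const, nsmul_eq_mul, ← sum_div]
          rw [hr]
      _ ≤ (η ^ (2 * r) * #P / (2 * r)) / (2 * a) + r * (#P * (a / 2)) := by
          gcongr
          rw [le_div_iff₀ (by positivity)]
          exact (mul_le_mul_of_nonneg_right h2 (by positivity)).trans hdev
      _ = _ := by
          rw [ha, two_mul r, pow_add]
          field_simp
          ring
  have hsum : 0 < ∑ ω ∈ P, ∏ S ∈ s, f S ω := by
    have h1 : #P * η ^ r ≤ #P * ∏ S ∈ s, p S := by gcongr
    have h2 : 0 < #P * (η ^ r * (1 / 4)) := by positivity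
    linarith
  obtain ⟨ω, hω, hne⟩ := exists_ne_zero_of_sum_ne_zero hsum.ne'
  refine ⟨ω, (mem_filter.1 hω).1, fun S hS => ?_⟩
  by_contra hX
  exact hne (prod_eq_zero hS (by simp [f, valueInd, hX]))

end Energy

section CountingTheorem

open Finset

variable {V Ω Q : Type}

open Classical in
lemma card_image_exposed_le [Fintype V] {F : Finset Ω} {k q : ℕ} {X : Finset V → Ω → Q}
    (hq : ∀ S, #S = k → #(F.image (X S)) ≤ q) (A : Finset V) :
    #(F.image (exposed k X A)) ≤
      q ^ #((powersetCard k (univ : Finset V)).filter (fun S => ¬ Disjoint S A)) := by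
  set R := (powersetCard k (univ : Finset V)).filter (fun S => ¬ Disjoint S A) with hR
  have hmem : ∀ S, S ∈ R ↔ #S = k ∧ ¬ Disjoint S A := by
    intro S; simp [hR, mem_powersetCard]
  have hsub : F.image (exposed k X A) ⊆ (R.pi fun S => F.image (X S)).image
      (fun h S => if hS : S ∈ R then some (h S hS) else none) := by
    intro x hx
    obtain ⟨ω, hω, rfl⟩ := mem_image.1 hx
    refine mem_image.2 ⟨fun S _ => X S ω, mem_pi.2 fun S _ => mem_image_of_mem _ hω, ?_⟩
    funext S
    simp only [exposed, ← hmem]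
    split_ifs <;> rfl
  calc _ ≤ #(R.pi fun S => F.image (X S)) := (card_le_card hsub).trans card_image_le
    _ = ∏ S ∈ R, #(F.image (X S)) := card_pi _ _
    _ ≤ ∏ S ∈ R, q := prod_le_prod' fun S hS => hq S ((hmem S).1 hS).1
    _ = _ := prod_const _

open Classical in
lemma card_not_disjoint_mul_le [Fintype V] {k : ℕ} (hk : 1 ≤ k) (A : Finset V) :
    #((powersetCard k (univ : Finset V)).filter (fun S => ¬ Disjoint S A)) * Fintype.card V ≤
      #A * (k * (Fintype.card V).choose k) := by
  rcases isEmpty_or_nonempty V with hV | hV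
  · simp
  obtain ⟨k, rfl⟩ := Nat.exists_eq_add_of_le' hk
  obtain ⟨n, hn⟩ := Nat.exists_eq_add_of_le' (Fintype.card_pos (α := V))
  have hsub : (powersetCard (k + 1) (univ : Finset V)).filter (fun S => ¬ Disjoint S A) ⊆
      A.biUnion fun a => (powersetCard k (univ.erase a)).image (insert a) := by
    intro S hS
    obtain ⟨hS, hd⟩ := mem_filter.1 hS
    obtain ⟨a, haS, haA⟩ := not_disjoint_iff.1 hd
    refine mem_biUnion.2 ⟨a, haA, mem_image.2 ⟨S.erase a, mem_powersetCard.2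
      ⟨erase_subset_erase _ (subset_univ _), ?_⟩, insert_erase haS⟩⟩
    rw [card_erase_of_mem haS, (mem_powersetCard.1 hS).2, Nat.add_sub_cancel]
  have hcard : #((powersetCard (k + 1) (univ : Finset V)).filter (fun S => ¬ Disjoint S A)) ≤
      #A * n.choose k := by
    refine (card_le_card hsub).trans (card_biUnion_le_card_mul _ _ _ fun a _ => ?_)
    refine card_image_le.trans ?_
    rw [card_powersetCard, card_erase_of_mem (mem_univ a), card_univ, hn, Nat.add_sub_cancel]
  rw [hn]
  have := Nat.add_one_mul_choose_eq n k
  calc _ ≤ #A * n.choose k * (n + 1) := Nat.mul_le_mul_right _ hcard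
    _ = #A * ((k + 1) * (n + 1).choose (k + 1)) := by
        rw [mul_assoc, mul_comm (n.choose k), this]; ring

open Classical in
/-- The counting bound with explicit parameters. -/
lemma log_card_le_of_params [Fintype V] {k m q T : ℕ} (hk : 1 ≤ k) (hkm : k ≤ m) (hq1 : 1 ≤ q)
    (hT : 0 < T) (hn : 2 * (k + (m - k)) ≤ Fintype.card V) {η lam W : ℝ} (hη : 0 < η)
    (hηq : q * η < 1) (hlam : 0 < lam) (hlam1 : lam ≤ 1) (hW : 0 ≤ W)
    {F : Finset Ω} (hF : F.Nonempty) {X : Finset V → Ω → Q}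
    (hq : ∀ S, #S = k → #(F.image (X S)) ≤ q)
    (hinj : ∀ ω ∈ F, ∀ ω' ∈ F, (∀ S, #S = k → X S ω = X S ω') → ω = ω')
    (hbound : ∀ M, #M = m → ∀ L : Finset V → Finset Q,
      (∀ S ∈ M.powersetCard k, (L S).Nonempty ∧ L S ⊆ F.image (X S)) →
      (∀ c : Finset V → Q, (∀ S ∈ M.powersetCard k, c S ∈ L S) →
        ∃ ω ∈ F, ∀ S ∈ M.powersetCard k, X S ω = c S) →
      ∑ S ∈ M.powersetCard k, Real.log #(L S) ≤ W * m.choose k) :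
    Real.log #F ≤ Real.log 2 + (T * (m - k : ℕ) * k / Fintype.card V * Real.log q +
      (lam * q + q * η * -Real.log lam) + W +
      2 * (2 ^ (m - k) * m.choose k * q / T) * (2 * m.choose k) / η ^ (2 * m.choose k) *
        Real.log q) * (Fintype.card V).choose k := by
  set n := Fintype.card V with hn'
  set w := m - k with hw
  set r := m.choose k with hr
  have hrpos : 0 < r := Nat.choose_pos hkm
  have hFpos : (0 : ℝ) < #F := Nat.cast_pos.2 hF.card_pos
  have hTpos : (0 : ℝ) < T := Nat.cast_pos.2 hT
  have hqpos : (0 : ℝ) < q := Nat.cast_pos.2 hq1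
  have hnpos : (0 : ℝ) < n := Nat.cast_pos.2 (by omega)
  have hlogq : 0 ≤ Real.log q := Real.log_nonneg (by exact_mod_cast hq1)
  have hchoose : (n.choose m : ℝ) * r = n.choose k * (n - k).choose w := by
    exact_mod_cast Nat.choose_mul (n := n) (k := m) (s := k) hkm
  have hcwpos : (0 : ℝ) < (n - k).choose w := Nat.cast_pos.2 (Nat.choose_pos (by omega))
  have hcmpos : (0 : ℝ) < n.choose m := Nat.cast_pos.2 (Nat.choose_pos (by omega))
  obtain ⟨A, hA, hdev⟩ := exists_small_deviation (m := m) F X hT hq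
  set ε₁ : ℝ := 2 ^ w * r * q / T with hε₁
  have hε₁pos : 0 < ε₁ := by positivity
  have hdev' : ∑ ω ∈ F, ∑ M ∈ powersetCard m (univ : Finset V), deviation F k X A M ω ≤
      (ε₁ * n.choose m) * #F := by
    refine hdev.trans ?_
    have h1 : (n.choose w : ℝ) ≤ 2 ^ w * (n - k).choose w := choose_le_two_pow_mul_choose hn
    calc (n.choose w : ℝ) * (n.choose k * (q * #F) / T)
        ≤ (2 ^ w * (n - k).choose w) * (n.choose k * (q * #F) / T) := by gcongr
      _ = 2 ^ w * (n.choose k * (n - k).choose w) * q / T * #F := by ring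
      _ = _ := by rw [← hchoose, hε₁]; ring
  obtain ⟨ω₀, hω₀, hlarge, hsmall⟩ := exists_large_fiber hF (card_image_exposed_le hq A)
    (mul_pos hε₁pos hcmpos)
    (fun ω => sum_nonneg fun M _ => deviation_nonneg F k X A M ω) hdev'
  set P := F.filter (fun a => exposed k X A a = exposed k X A ω₀) with hP
  set R := (powersetCard k (univ : Finset V)).filter (fun S => ¬ Disjoint S A) with hR
  have hPne : P.Nonempty := ⟨ω₀, mem_filter.2 ⟨hω₀, rfl⟩⟩
  have hPF : P ⊆ F := filter_subset _ _
  have hPpos : (0 : ℝ) < #P := Nat.cast_pos.2 hPne.card_pos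
  -- the exceptional sets
  set bad := (powersetCard m (univ : Finset V)).filter (fun M =>
    η ^ (2 * r) * #P < ∑ ω ∈ P, deviation F k X A M ω * (2 * r)) with hbad
  have hηr : 0 < η ^ (2 * r) := by positivity
  have hbadcard : (#bad : ℝ) ≤ 2 * ε₁ * (2 * r) / η ^ (2 * r) * n.choose m := by
    rw [sum_comm] at hsmall
    have h1 : (#bad : ℝ) * (η ^ (2 * r) * #P) ≤
        ∑ M ∈ powersetCard m (univ : Finset V), ∑ ω ∈ P, deviation F k X A M ω * (2 * r) := by
      rw [← nsmul_eq_mul, ← sum_const]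
      refine (sum_le_sum fun M hM => (mem_filter.1 hM).2.le).trans ?_
      refine sum_le_sum_of_subset_of_nonneg (filter_subset _ _) fun M _ _ => ?_
      exact sum_nonneg fun ω _ => mul_nonneg (deviation_nonneg F k X A M ω) (by positivity)
    simp only [← sum_mul] at h1
    have h2 : (#bad : ℝ) * η ^ (2 * r) * #P ≤ (2 * ε₁ * n.choose m * (2 * r)) * #P := by
      have := mul_le_mul_of_nonneg_right hsmall (by positivity : (0 : ℝ) ≤ 2 * r)
      linarith
    have h3 := le_of_mul_le_mul_right h2 hPpos
    rw [div_mul_eq_mul_div, le_div_iff₀ hηr]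
    linarith
  -- the lists of frequent values
  let L : Finset V → Finset Q := fun S =>
    (F.image (X S)).filter (fun c => η * #P ≤ #(P.filter (fun ω => X S ω = c)))
  have hLsub : ∀ S, L S ⊆ F.image (X S) := fun S => filter_subset _ _
  have hLne : ∀ S, #S = k → (L S).Nonempty := by
    intro S hS
    by_contra h
    rw [not_nonempty_iff_eq_empty, filter_eq_empty_iff] at h
    have h1 : (#P : ℝ) = ∑ c ∈ F.image (X S), (#(P.filter (fun ω => X S ω = c)) : ℝ) := by
      exact_mod_cast card_eq_sum_card_fiberwise
        (fun ω hω => mem_image_of_mem (X S) (hPF hω))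
    have h2 : ∑ c ∈ F.image (X S), (#(P.filter (fun ω => X S ω = c)) : ℝ) ≤
        ∑ c ∈ F.image (X S), η * #P := sum_le_sum fun c hc => (not_le.1 (h hc)).le
    rw [sum_const, nsmul_eq_mul] at h2
    have h3 : (#(F.image (X S)) : ℝ) * (η * #P) ≤ q * (η * #P) := by
      gcongr
      exact hq S hS
    nlinarith [mul_lt_mul_of_pos_right hηq hPpos]
  have hLlog : ∀ S, #S = k → 0 ≤ Real.log #(L S) ∧ Real.log #(L S) ≤ Real.log q := by
    intro S hS
    have h1 : (1 : ℝ) ≤ #(L S) := by exact_mod_cast (hLne S hS).card_pos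
    refine ⟨Real.log_nonneg h1, Real.log_le_log (by linarith) ?_⟩
    exact_mod_cast (card_le_card (hLsub S)).trans (hq S hS)
  have hlist := log_card_le_sum_log_card hPne (powersetCard k (univ : Finset V)) X
    (fun S => F.image (X S)) L (q := q) hη.le hlam hlam1
    (fun ω hω ω' hω' h => hinj ω (hPF hω) ω' (hPF hω') fun S hS =>
      h S (mem_powersetCard.2 ⟨subset_univ _, hS⟩))
    (fun S _ ω hω => mem_image_of_mem _ (hPF hω))
    (fun S hS => hq S (mem_powersetCard.1 hS).2)
    (fun S hS => hLne S (mem_powersetCard.1 hS).2) (fun S _ => hLsub S)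
    (fun S _ c hc hcL => by
      have : ¬ η * #P ≤ #(P.filter (fun ω => X S ω = c)) := fun h =>
        hcL (mem_filter.2 ⟨hc, h⟩)
      exact (not_le.1 this).le)
  rw [card_powersetCard, card_univ, ← hn'] at hlist
  have hgood : ∀ M ∈ powersetCard m (univ : Finset V), M ∉ bad →
      ∑ S ∈ M.powersetCard k, Real.log #(L S) ≤ W * r := by
    intro M hM hMbad
    have hMm := (mem_powersetCard.1 hM).2
    have hMr : #(M.powersetCard k) = r := by rw [card_powersetCard, hMm]
    refine hbound M hMm L (fun S hS => ⟨hLne S (mem_powersetCard.1 hS).2, hLsub S⟩)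
      fun c hc => ?_
    refine exists_simultaneous hη hω₀ ?_ (card_pos.1 (by rw [hMr]; exact hrpos)) fun S hS =>
      (mem_filter.1 (hc S hS)).2
    rw [hMr]
    exact not_lt.1 fun h => hMbad (mem_filter.2 ⟨hM, h⟩)
  have hsum : ((n - k).choose w : ℝ) * ∑ S ∈ powersetCard k (univ : Finset V),
      Real.log #(L S) ≤ n.choose m * (W * r) + #bad * (r * Real.log q) := by
    have h1 := sum_powersetCard_powersetCard hkm (univ : Finset V) (fun S => Real.log #(L S))
    rw [card_univ, ← hn', ← hw] at h1
    rw [← h1]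
    calc ∑ M ∈ powersetCard m (univ : Finset V), ∑ S ∈ M.powersetCard k, Real.log #(L S)
        ≤ ∑ M ∈ powersetCard m (univ : Finset V),
            (W * r + if M ∈ bad then r * Real.log q else 0) := by
          refine sum_le_sum fun M hM => ?_
          split_ifs with hMbad
          · have h2 : ∑ S ∈ M.powersetCard k, Real.log #(L S) ≤
                ∑ S ∈ M.powersetCard k, Real.log q :=
              sum_le_sum fun S hS => (hLlog S (mem_powersetCard.1 hS).2).2
            rw [sum_const, nsmul_eq_mul, card_powersetCard, (mem_powersetCard.1 hM).2] at h2
            have : 0 ≤ W * r := by positivity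
            linarith
          · rw [add_zero]
            exact hgood M hM hMbad
      _ = _ := by
          rw [sum_add_distrib, ← sum_filter, sum_const, sum_const, nsmul_eq_mul, nsmul_eq_mul,
            card_powersetCard, card_univ, filter_mem_eq_inter,
            inter_eq_right.2 (filter_subset _ _)]
  have hsum' : ∑ S ∈ powersetCard k (univ : Finset V), Real.log #(L S) ≤
      (W + 2 * ε₁ * (2 * r) / η ^ (2 * r) * Real.log q) * n.choose k := by
    refine le_of_mul_le_mul_left (hsum.trans ?_) hcwpos
    have h1 := mul_le_mul_of_nonneg_right hbadcard (by positivity : 0 ≤ r * Real.log q)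
    calc n.choose m * (W * r) + #bad * (r * Real.log q)
        ≤ n.choose m * (W * r) +
          2 * ε₁ * (2 * r) / η ^ (2 * r) * n.choose m * (r * Real.log q) := by linarith
      _ = (n.choose m * r) * (W + 2 * ε₁ * (2 * r) / η ^ (2 * r) * Real.log q) := by ring
      _ = _ := by rw [hchoose]; ring
  have hlogF : Real.log #F ≤ Real.log 2 + #R * Real.log q + Real.log #P := by
    have h1 := Real.log_le_log hFpos hlarge
    push_cast at h1
    rwa [Real.log_mul (by positivity) hPpos.ne', Real.log_mul (by norm_num) (by positivity),
      Real.log_pow] at h1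
  have hRcard : (#R : ℝ) ≤ T * w * k / n * n.choose k := by
    have h1 := card_not_disjoint_mul_le hk A
    have h2 : (#R : ℝ) * n ≤ #A * (k * n.choose k) := by exact_mod_cast h1
    have h3 : (#A : ℝ) ≤ T * w := by exact_mod_cast hA
    rw [div_mul_eq_mul_div, le_div_iff₀ hnpos]
    calc (#R : ℝ) * n ≤ #A * (k * n.choose k) := h2
      _ ≤ (T * w) * (k * n.choose k) := by gcongr
      _ = _ := by ring
  have := mul_le_mul_of_nonneg_right hRcard hlogq
  linarith

open Classical in
/-- A family that is determined by bounded local data, and whose independent local lists have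
average logarithmic size at most `W`, has at most about `exp (W * choose n k)` members. -/
lemma exists_forall_log_card_le {k m q : ℕ} (hk : 1 ≤ k) (hkm : k ≤ m) (hq1 : 1 ≤ q) {ε : ℝ}
    (hε : 0 < ε) :
    ∃ n₀ : ℕ, ∀ (V Ω Q : Type) [Fintype V] (F : Finset Ω) (X : Finset V → Ω → Q) (W : ℝ),
      n₀ ≤ Fintype.card V → 0 ≤ W → F.Nonempty →
      (∀ S, #S = k → #(F.image (X S)) ≤ q) →
      (∀ ω ∈ F, ∀ ω' ∈ F, (∀ S, #S = k → X S ω = X S ω') → ω = ω') →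
      (∀ M, #M = m → ∀ L : Finset V → Finset Q,
        (∀ S ∈ M.powersetCard k, (L S).Nonempty ∧ L S ⊆ F.image (X S)) →
        (∀ c : Finset V → Q, (∀ S ∈ M.powersetCard k, c S ∈ L S) →
          ∃ ω ∈ F, ∀ S ∈ M.powersetCard k, X S ω = c S) →
        ∑ S ∈ M.powersetCard k, Real.log #(L S) ≤ W * m.choose k) →
      Real.log #F ≤ (W + ε) * (Fintype.card V).choose k := by
  have hqpos : (0 : ℝ) < q := Nat.cast_pos.2 hq1
  have hlogq : 0 ≤ Real.log q := Real.log_nonneg (by exact_mod_cast hq1)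
  have hrpos : (0 : ℝ) < m.choose k := Nat.cast_pos.2 (Nat.choose_pos hkm)
  obtain ⟨lam, hlam, hlam1, hlamq⟩ : ∃ lam : ℝ, 0 < lam ∧ lam ≤ 1 ∧ lam * q ≤ ε / 5 := by
    refine ⟨min 1 (ε / 5 / q), by positivity, min_le_left _ _, ?_⟩
    rw [← le_div_iff₀ hqpos]
    exact min_le_right _ _
  have hL : 0 ≤ -Real.log lam := by linarith [Real.log_nonpos hlam.le hlam1]
  obtain ⟨η, hη, hηq, hηL⟩ : ∃ η : ℝ, 0 < η ∧ q * η < 1 ∧ q * η * -Real.log lam ≤ ε / 5 := by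
    set K := -Real.log lam with hK
    refine ⟨min (1 / 2) (ε / 5 / (K + 1)) / q, by positivity, ?_, ?_⟩
    · rw [mul_div_cancel₀ _ hqpos.ne']
      exact (min_le_left _ _).trans_lt (by norm_num)
    · rw [mul_div_cancel₀ _ hqpos.ne']
      calc min (1 / 2) (ε / 5 / (K + 1)) * K ≤ ε / 5 / (K + 1) * (K + 1) := by
            have := min_le_right (1 / 2) (ε / 5 / (K + 1))
            have h0 : 0 ≤ ε / 5 / (K + 1) := by positivity
            nlinarith
        _ = ε / 5 := by field_simp
  set D : ℝ := 2 * (2 ^ (m - k) * m.choose k * q) * (2 * m.choose k) / η ^ (2 * m.choose k) *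
    Real.log q with hD
  have hD0 : 0 ≤ D := by positivity
  obtain ⟨T, hT⟩ := exists_nat_gt (D / (ε / 5))
  have hTpos : (0 : ℝ) < T := (by positivity : 0 ≤ D / (ε / 5)).trans_lt hT
  have hDT : D / T ≤ ε / 5 := by
    rw [div_le_iff₀ hTpos]
    rw [div_lt_iff₀ (by positivity)] at hT
    linarith
  obtain ⟨n₁, hn₁⟩ := exists_nat_gt (T * (m - k : ℕ) * k * Real.log q / (ε / 5))
  obtain ⟨n₂, hn₂⟩ := exists_nat_gt (Real.log 2 * (2 ^ k * k.factorial) / (ε / 5))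
  refine ⟨n₁ + n₂ + 2 * (k + (m - k)), fun V Ω Q _ F X W hn hW hF hq hinj hbound => ?_⟩
  set n := Fintype.card V with hn'
  have hmain := log_card_le_of_params hk hkm hq1 (Nat.cast_pos.1 hTpos) (by omega) hη hηq hlam
    hlam1 hW hF hq hinj hbound
  rw [← hn'] at hmain
  have hnpos : (0 : ℝ) < n := Nat.cast_pos.2 (by omega)
  have h1 : T * (m - k : ℕ) * k / n * Real.log q ≤ ε / 5 := by
    rw [div_mul_eq_mul_div, div_le_iff₀ hnpos]
    rw [div_lt_iff₀ (by positivity)] at hn₁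
    have : (n₁ : ℝ) ≤ n := by exact_mod_cast (by omega : n₁ ≤ n)
    nlinarith
  have h2 : 2 * (2 ^ (m - k) * m.choose k * q / T) * (2 * m.choose k) / η ^ (2 * m.choose k) *
      Real.log q ≤ ε / 5 := by
    refine le_of_eq_of_le ?_ hDT
    rw [hD]
    field_simp
  have h3 : Real.log 2 ≤ ε / 5 * n.choose k := by
    have hc : (n : ℝ) ^ k ≤ (2 ^ k * k.factorial) * n.choose k := pow_le_mul_choose (by omega)
    have hnk : (n : ℝ) ≤ (n : ℝ) ^ k := by
      refine le_self_pow₀ ?_ (by omega)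
      exact_mod_cast (by omega : 1 ≤ n)
    rw [div_lt_iff₀ (by positivity)] at hn₂
    have : (n₂ : ℝ) ≤ n := by exact_mod_cast (by omega : n₂ ≤ n)
    have hK : (0 : ℝ) < 2 ^ k * k.factorial := by positivity
    have h4 : Real.log 2 * (2 ^ k * k.factorial) ≤
        (ε / 5 * n.choose k) * (2 ^ k * k.factorial) := by
      have h5 : (n₂ : ℝ) ≤ (2 ^ k * k.factorial) * n.choose k := this.trans (hnk.trans hc)
      nlinarith
    exact le_of_mul_le_mul_right h4 hK
  have hN : (0 : ℝ) ≤ n.choose k := Nat.cast_nonneg _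
  refine hmain.trans ?_
  have h6 : T * (m - k : ℕ) * k / n * Real.log q + (lam * q + q * η * -Real.log lam) + W +
      2 * (2 ^ (m - k) * m.choose k * q / T) * (2 * m.choose k) / η ^ (2 * m.choose k) *
        Real.log q ≤ W + 4 * (ε / 5) := by linarith
  have := mul_le_mul_of_nonneg_right h6 hN
  linarith

end CountingTheorem

section SatFunctions

open Finset

variable {V : Type} [DecidableEq V]

/-- Every formula contains a minimal formula computing the same function. -/
lemma exists_minimal_subformula (G : SatFormula V) :
    ∃ G' ⊆ G, MinimalFormula G' ∧ ∀ a : V → Bool,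
      (∃ C ∈ G', SatisfiesClause a C) ↔ ∃ C ∈ G, SatisfiesClause a C := by
  induction G using Finset.strongInduction with
  | H G ih =>
    by_cases hG : MinimalFormula G
    · exact ⟨G, Subset.rfl, hG, fun a => Iff.rfl⟩
    · unfold MinimalFormula at hG
      push Not at hG
      obtain ⟨C, hC, hw⟩ := hG
      obtain ⟨G', hG', hmin, heq⟩ := ih (G.erase C) (erase_ssubset hC)
      refine ⟨G', hG'.trans (erase_subset _ _), hmin, fun a => (heq a).trans ⟨?_, ?_⟩⟩
      · rintro ⟨D, hD, hsat⟩
        exact ⟨D, mem_of_mem_erase hD, hsat⟩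
      · rintro ⟨D, hD, hsat⟩
        by_cases hDC : D = C
        · subst hDC
          obtain ⟨D', hD', hsat', hne⟩ := hw a hsat
          exact ⟨D', mem_erase.2 ⟨hne, hD'⟩, hsat'⟩
        · exact ⟨D, mem_erase.2 ⟨hDC, hD⟩, hsat⟩

/-- The minimal `k`-SAT formulas on `V`. -/
noncomputable def minimalFormulas (V : Type) [DecidableEq V] [Fintype V] (k : ℕ) :
    Finset (SatFormula V) :=
  @Finset.filter _ (fun G => IsKFormula k G ∧ MinimalFormula G) (Classical.decPred _) univ

lemma mem_minimalFormulas [Fintype V] {k : ℕ} {G : SatFormula V} :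
    G ∈ minimalFormulas V k ↔ IsKFormula k G ∧ MinimalFormula G := by
  simp [minimalFormulas]

/-- Distinct `k`-SAT functions are computed by distinct minimal formulas. -/
lemma ncard_isKSatFunction_le (k n : ℕ) :
    Set.ncard {f : (Fin n → Bool) → Bool | IsKSatFunction k n f} ≤
      #(minimalFormulas (Fin n) k) := by
  classical
  rw [← Set.ncard_coe_finset]
  refine (Set.ncard_le_ncard (t := (fun (G : SatFormula (Fin n)) (a : Fin n → Bool) =>
    decide (∃ C ∈ G, SatisfiesClause a C)) '' (minimalFormulas (Fin n) k : Set _)) ?_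
    (Set.toFinite _)).trans (Set.ncard_image_le (Set.toFinite _))
  rintro f ⟨G, hG, hf⟩
  obtain ⟨G', hsub, hmin, heq⟩ := exists_minimal_subformula G
  refine ⟨G', mem_coe.2 (mem_minimalFormulas.2 ⟨fun C hC => hG C (hsub hC), hmin⟩), ?_⟩
  funext a
  rw [Bool.eq_iff_iff, decide_eq_true_iff, heq a, hf a]

/-- The number of minimal `k`-SAT formulas is governed by the Turán density. -/
lemma exists_forall_log_card_minimalFormulas_le {k : ℕ} (hk : 2 ≤ k) {ε : ℝ} (hε : 0 < ε) :
    ∃ n₀ : ℕ, ∀ n ≥ n₀, Real.log #(minimalFormulas (Fin n) k) ≤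
      Real.log 2 * (piTuran k (Real.logb 2 3) + ε) * n.choose k := by
  classical
  have hθ : 0 ≤ Real.logb 2 3 := Real.logb_nonneg (by norm_num) (by norm_num)
  have hlog2 : 0 < Real.log 2 := Real.log_pos (by norm_num)
  obtain ⟨p, hp, hplt⟩ := exists_turanBound_lt k hθ (by linarith : 0 < ε / 4)
  have hp0 := hp.nonneg
  obtain ⟨m, hkm, hm⟩ := exists_realizableLists_bound hk hp (by linarith : 0 < ε / 4)
  obtain ⟨n₀, hn₀⟩ := exists_forall_log_card_le (q := 2 ^ 2 ^ k) (by omega : 1 ≤ k) hkm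
    Nat.one_le_two_pow (by positivity : 0 < Real.log 2 * (ε / 4))
  refine ⟨n₀, fun n hn => ?_⟩
  set F := minimalFormulas (Fin n) k with hF
  let X : Finset (Fin n) → SatFormula (Fin n) → SatFormula (Fin n) :=
    fun S G => G.filter fun C => clauseVars C = S
  have hX : ∀ S, ∀ G ∈ F, ∀ C ∈ X S G, IsKClause k C ∧ clauseVars C = S := by
    intro S G hG C hC
    obtain ⟨hC, hS⟩ := mem_filter.1 hC
    exact ⟨(mem_minimalFormulas.1 hG).1 C hC, hS⟩
  have hmem : ∀ (_ : DecidableEq (SatFormula (Fin n))) S g, g ∈ F.image (X S) →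
      ∃ G ∈ F, X S G = g := fun _ S g h => mem_image.1 h
  have hmain := hn₀ (Fin n) (SatFormula (Fin n)) (SatFormula (Fin n)) F X
    (Real.log 2 * (p + ε / 4)) (by simpa using hn) (by positivity)
    ⟨∅, mem_minimalFormulas.2 ⟨by simp [IsKFormula], by simp [MinimalFormula]⟩⟩ ?_ ?_ ?_
  · rw [Fintype.card_fin] at hmain
    refine hmain.trans ?_
    gcongr
    nlinarith
  · intro S hS
    refine card_le_of_forall_isKClause hS fun g hg => ?_
    obtain ⟨G, hG, rfl⟩ := hmem _ S g hg
    exact hX S G hG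
  · have key : ∀ G ∈ F, ∀ G' ∈ F, (∀ S, #S = k → X S G = X S G') → G ⊆ G' := by
      intro G hG G' _ h C hC
      have hCk := (mem_minimalFormulas.1 hG).1 C hC
      have : C ∈ X (clauseVars C) G := mem_filter.2 ⟨hC, rfl⟩
      rw [h _ hCk.2] at this
      exact (mem_filter.1 this).1
    intro G hG G' hG' h
    exact (key G hG G' hG' h).antisymm (key G' hG' G hG fun S hS => (h S hS).symm)
  · intro M hM L hL hsel
    refine hm (Fin n) M L hM ⟨?_, fun S hS => (hL S hS).1, ?_⟩
    · intro S hS g hg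
      obtain ⟨G, hG, rfl⟩ := hmem _ S g ((hL S hS).2 hg)
      exact hX S G hG
    · intro c hc
      obtain ⟨G, hG, hGc⟩ := hsel c hc
      refine ⟨G, (mem_minimalFormulas.1 hG).2, fun S hS => ?_⟩
      rw [← hGc S hS]
      exact filter_subset _ _

end SatFunctions

/-- For `k ≥ 2` and every `ε > 0`, for all sufficiently large `n` the number
of `k`-SAT functions on `n` Boolean variables is at most
`2^((π(T_k, log₂3) + ε)·C(n,k))`. -/
theorem weak_count (k : ℕ) (hk : 2 ≤ k) (ε : ℝ) (hε : 0 < ε) :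
    ∃ n₀ : ℕ, ∀ n ≥ n₀,
      (Set.ncard {f : (Fin n → Bool) → Bool | IsKSatFunction k n f} : ℝ) ≤
        (2 : ℝ) ^ ((piTuran k (Real.logb 2 3) + ε) * (n.choose k : ℝ)) := by
  obtain ⟨n₀, hn₀⟩ := exists_forall_log_card_minimalFormulas_le hk hε
  refine ⟨n₀, fun n hn => ?_⟩
  have hle : (Set.ncard {f : (Fin n → Bool) → Bool | IsKSatFunction k n f} : ℝ) ≤
      (minimalFormulas (Fin n) k).card := by exact_mod_cast ncard_isKSatFunction_le k n
  refine hle.trans ?_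
  have hpos : (0 : ℝ) < (minimalFormulas (Fin n) k).card :=
    Nat.cast_pos.2 (Finset.card_pos.2
      ⟨∅, mem_minimalFormulas.2 ⟨by simp [IsKFormula], by simp [MinimalFormula]⟩⟩)
  rw [Real.rpow_def_of_pos two_pos, ← mul_assoc, ← Real.log_le_iff_le_exp hpos]
  exact hn₀ n hn
end
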